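/- Let a(z) = (1+z)/2, b₀(z) = z(1−z)/2, and I(z) = zB(z), where B is a Blaschke product whose zero sequence {rₙ} lies in (−1,0) and converges to −1. Set b = I·b₀ and f = a/(1−b). Then the orthogonal complement of fK_I in ker T_{Ī f̄ / f} is one dimensional and is spanned by the function g(z) = f(z)·(1+I(z))/(1+z). -/

import Mathlib

open Complex MeasureTheory Filter Set

noncomputable section

/-! ### Basic framework: Hardy spaces on the unit disk via boundary values -/

/-- The open unit disk in the complex plane. -/
def unitDisk : Set ℂ := Metric.ball 0 1

/-- The point `e^{iθ}` of the unit circle. -/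
def uc (θ : ℝ) : ℂ := Complex.exp ((θ : ℂ) * Complex.I)

/-- Lebesgue measure on the parameter interval `(0, 2π]` of the unit circle. -/
def bMeasure : Measure ℝ := volume.restrict (Set.Ioc 0 (2 * Real.pi))

/-- Radial limit of `f` at the boundary point `w` (`|w| = 1`). -/
def radLim (f : ℂ → ℂ) (w : ℂ) : ℂ :=
  limUnder (nhdsWithin (1 : ℝ) (Set.Iio 1)) fun r : ℝ => f ((r : ℂ) * w)

/-- The boundary value function of `f` on the unit circle. -/
def bdry (f : ℂ → ℂ) (θ : ℝ) : ℂ := radLim f (uc θ)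

/-- Membership in the Hardy space `H²` of the unit disk. -/
def MemH2 (f : ℂ → ℂ) : Prop :=
  DifferentiableOn ℂ f unitDisk ∧
    ∃ C : ℝ, ∀ r ∈ Set.Ico (0 : ℝ) 1,
      (∫ θ in (0:ℝ)..(2 * Real.pi), ‖f ((r : ℂ) * uc θ)‖ ^ 2) ≤ C

/-- Membership in the Hardy space `H¹` of the unit disk. -/
def MemH1 (f : ℂ → ℂ) : Prop :=
  DifferentiableOn ℂ f unitDisk ∧
    ∃ C : ℝ, ∀ r ∈ Set.Ico (0 : ℝ) 1,
      (∫ θ in (0:ℝ)..(2 * Real.pi), ‖f ((r : ℂ) * uc θ)‖) ≤ C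

/-- Membership in `H^∞` (bounded holomorphic functions on the disk). -/
def MemHinf (f : ℂ → ℂ) : Prop :=
  DifferentiableOn ℂ f unitDisk ∧ ∃ C : ℝ, ∀ z ∈ unitDisk, ‖f z‖ ≤ C

/-- The `H²` (normalized boundary `L²`) inner product `⟨f, g⟩`. -/
def bInner (f g : ℂ → ℂ) : ℂ :=
  (1 / (2 * (Real.pi : ℂ))) *
    ∫ θ in (0:ℝ)..(2 * Real.pi), bdry f θ * (starRingEnd ℂ) (bdry g θ)

/-- The squared `H²` norm, computed on the boundary. -/
def bNormSq (f : ℂ → ℂ) : ℝ :=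
  (1 / (2 * Real.pi)) * ∫ θ in (0:ℝ)..(2 * Real.pi), ‖bdry f θ‖ ^ 2

/-- `f` is an inner function. -/
def IsInner (f : ℂ → ℂ) : Prop :=
  DifferentiableOn ℂ f unitDisk ∧ (∀ z ∈ unitDisk, ‖f z‖ ≤ 1) ∧
    ∀ᵐ θ ∂bMeasure, ‖bdry f θ‖ = 1

/-- `f` is an outer function: it is, up to a unimodular constant, the Herglotz
exponential of the Poisson integral of `log |f*|`. -/
def IsOuter (f : ℂ → ℂ) : Prop :=
  DifferentiableOn ℂ f unitDisk ∧ ∃ c : ℂ, ‖c‖ = 1 ∧ ∀ z ∈ unitDisk,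
    f z = c * Complex.exp ((1 / (2 * (Real.pi : ℂ))) *
      ∫ θ in (0:ℝ)..(2 * Real.pi),
        ((uc θ + z) / (uc θ - z)) * ((Real.log ‖bdry f θ‖ : ℝ) : ℂ))

/-- `b` is a nonextreme point of the closed unit ball of `H^∞`:
`log (1 - |b|)` is integrable on the circle. -/
def Nonextreme (b : ℂ → ℂ) : Prop :=
  DifferentiableOn ℂ b unitDisk ∧ (∀ z ∈ unitDisk, ‖b z‖ ≤ 1) ∧
    Integrable (fun θ => Real.log (1 - ‖bdry b θ‖)) bMeasure

/-- `(b, a)` is a pair: `b` nonextreme, `a` outer, `|a|² + |b|² = 1` a.e. on the circle. -/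
def IsPair (b a : ℂ → ℂ) : Prop :=
  Nonextreme b ∧ IsOuter a ∧
    ∀ᵐ θ ∂bMeasure, ‖bdry a θ‖ ^ 2 + ‖bdry b θ‖ ^ 2 = 1

/-- `(b, a)` is the pair associated with the outer function `f` of unit `H²` norm:
`f = a / (1 - b)`. -/
def PairAssoc (f b a : ℂ → ℂ) : Prop :=
  IsOuter f ∧ MemH2 f ∧ bNormSq f = 1 ∧ IsPair b a ∧
    ∀ z ∈ unitDisk, f z = a z / (1 - b z)

/-- The Herglotz measure `μ_λ` of `(1 + λ̄b)/(1 − λ̄b)` is absolutely continuous: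
the Herglotz representation holds with density `|a/(1 − λ̄b)|²` and no singular part. -/
def HerglotzAC (b a : ℂ → ℂ) (lam : ℂ) : Prop :=
  ∀ z ∈ unitDisk,
    (1 + (starRingEnd ℂ) lam * b z) / (1 - (starRingEnd ℂ) lam * b z) =
      (1 / (2 * (Real.pi : ℂ))) *
        (∫ θ in (0:ℝ)..(2 * Real.pi),
          ((1 + (uc θ)⁻¹ * z) / (1 - (uc θ)⁻¹ * z)) *
            ((‖bdry (fun w => a w / (1 - (starRingEnd ℂ) lam * b w)) θ‖ ^ 2 : ℝ) : ℂ)) +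
      Complex.I *
        ((((1 + (starRingEnd ℂ) lam * b 0) / (1 - (starRingEnd ℂ) lam * b 0)).im : ℝ) : ℂ)

/-- The pair `(b, a)` is special: the Herglotz measure of `(1+b)/(1−b)` is
absolutely continuous. -/
def SpecialPair (b a : ℂ → ℂ) : Prop := IsPair b a ∧ HerglotzAC b a 1

/-- `F ∈ H¹` is rigid: the only functions of `H¹` with the same argument a.e. on the
circle are the positive scalar multiples of `F`. -/
def Rigid (F : ℂ → ℂ) : Prop :=
  MemH1 F ∧ ∀ G : ℂ → ℂ, MemH1 G →
    (∀ᵐ θ ∂bMeasure, ∃ t : ℝ, 0 < t ∧ bdry G θ = (t : ℂ) * bdry F θ) →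
    ∃ c : ℝ, 0 < c ∧ ∀ z ∈ unitDisk, G z = (c : ℂ) * F z

/-- The Riesz (analytic) projection `P₊` of a boundary function, realized through the
Szegő integral: `(P₊u)(z) = (1/2π) ∫ u(θ) (1 − z e^{-iθ})⁻¹ dθ`. -/
def szProj (u : ℝ → ℂ) : ℂ → ℂ := fun z =>
  (1 / (2 * (Real.pi : ℂ))) *
    ∫ θ in (0:ℝ)..(2 * Real.pi), u θ * (1 - z * (uc θ)⁻¹)⁻¹

/-- The Toeplitz operator with boundary symbol `φ`: `T_φ h = P₊(φ · h*)`. -/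
def toeplitz (φ : ℝ → ℂ) (h : ℂ → ℂ) : ℂ → ℂ := szProj fun θ => φ θ * bdry h θ

/-- The kernel of the Toeplitz operator `T_φ`, as a subset of `H²`. -/
def toeplitzKer (φ : ℝ → ℂ) : Set (ℂ → ℂ) :=
  {h | MemH2 h ∧ ∀ z ∈ unitDisk, toeplitz φ h z = 0}

/-- The boundary symbol `ḡ` of a function `g` on the disk. -/
def conjBdry (g : ℂ → ℂ) : ℝ → ℂ := fun θ => (starRingEnd ℂ) (bdry g θ)

/-- The boundary symbol `ḡ/g`. -/
def symbQuot (g : ℂ → ℂ) : ℝ → ℂ := fun θ => (starRingEnd ℂ) (bdry g θ) / bdry g θ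

/-- The boundary symbol `Ī f̄ / f`. -/
def symbIf (I f : ℂ → ℂ) : ℝ → ℂ :=
  fun θ => (starRingEnd ℂ) (bdry I θ) * (starRingEnd ℂ) (bdry f θ) / bdry f θ

/-- The model space `K_I = H² ⊖ I H² = ker T_Ī` of an inner function `I`. -/
def modelSpace (I : ℂ → ℂ) : Set (ℂ → ℂ) := toeplitzKer (conjBdry I)

/-- The set `f·K_I`. -/
def fModel (f I : ℂ → ℂ) : Set (ℂ → ℂ) :=
  {g | ∃ h ∈ modelSpace I, ∀ z ∈ unitDisk, g z = f z * h z}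

/-- The orthogonal complement `ker T_{Ī f̄/f} ⊖ f·K_I` of `f·K_I` in the kernel of
`T_{Ī f̄/f}`, with respect to the `H²` inner product. -/
def kerPerp (I f : ℂ → ℂ) : Set (ℂ → ℂ) :=
  {h | h ∈ toeplitzKer (symbIf I f) ∧ ∀ g ∈ fModel f I, bInner h g = 0}

/-- `M(a) = T_a H² = a·H²` (for `a ∈ H^∞`), the range of `T_a`, as a set. -/
def rangeMa (a : ℂ → ℂ) : Set (ℂ → ℂ) :=
  {g | ∃ h, MemH2 h ∧ ∀ z ∈ unitDisk, g z = a z * h z}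

/-- Membership in the de Branges–Rovnyak space `H(b)` for nonextreme `b` with
pair `(b, a)`:  `h ∈ H(b)` iff `h ∈ H²` and `T_b̄ h = T_ā h⁺` for some `h⁺ ∈ H²`
(Sarason's characterization). -/
def MemHb (b a h : ℂ → ℂ) : Prop :=
  MemH2 h ∧ ∃ h' : ℂ → ℂ, MemH2 h' ∧
    ∀ z ∈ unitDisk, toeplitz (conjBdry b) h z = toeplitz (conjBdry a) h' z

/-- The function `h⁺ ∈ H²` with `T_b̄ h = T_ā h⁺` (unique when it exists, since `a`
is outer). -/
def plusFun (b a h : ℂ → ℂ) : ℂ → ℂ :=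
  Classical.epsilon fun h' : ℂ → ℂ => MemH2 h' ∧
    ∀ z ∈ unitDisk, toeplitz (conjBdry b) h z = toeplitz (conjBdry a) h' z

/-- The inner product of `H(b)`: `⟨h, g⟩_b = ⟨h, g⟩₂ + ⟨h⁺, g⁺⟩₂`. -/
def hbInner (b a h g : ℂ → ℂ) : ℂ :=
  bInner h g + bInner (plusFun b a h) (plusFun b a g)

/-- The squared norm of `H(b)`. -/
def hbNormSq (b a h : ℂ → ℂ) : ℝ := (hbInner b a h h).re

/-- The closure of a set `S` in the norm of `H(b)`. -/
def hbClosure (b a : ℂ → ℂ) (S : Set (ℂ → ℂ)) : Set (ℂ → ℂ) :=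
  {h | MemHb b a h ∧ ∀ ε : ℝ, 0 < ε → ∃ g ∈ S,
    hbNormSq b a (fun z => h z - g z) < ε}

/-- The orthogonal complement of `S` in `H(b)`. -/
def hbPerp (b a : ℂ → ℂ) (S : Set (ℂ → ℂ)) : Set (ℂ → ℂ) :=
  {h | MemHb b a h ∧ ∀ g ∈ S, hbInner b a h g = 0}

/-- A set of functions on the disk is a `k`-dimensional linear subspace. -/
def HasDimOn (S : Set (ℂ → ℂ)) (k : ℕ) : Prop :=
  ∃ g : Fin k → (ℂ → ℂ), (∀ j, g j ∈ S) ∧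
    (∀ c : Fin k → ℂ, (∀ z ∈ unitDisk, (∑ j, c j * g j z) = 0) → c = 0) ∧
    ∀ h ∈ S, ∃ c : Fin k → ℂ, ∀ z ∈ unitDisk, h z = ∑ j, c j * g j z

/-- The Szegő kernel `k_w(z) = (1 - w̄ z)⁻¹` of `H²`. -/
def szKernel (w z : ℂ) : ℂ := (1 - (starRingEnd ℂ) w * z)⁻¹

/-- The reproducing kernel of `H(b)` at an interior point `w ∈ 𝔻`. -/
def hbKernel (b : ℂ → ℂ) (w z : ℂ) : ℂ :=
  (1 - (starRingEnd ℂ) (b w) * b z) / (1 - (starRingEnd ℂ) w * z)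

/-- The boundary kernel of `H(b)` at a boundary point `z₀`, defined through the
nontangential limit `b(z₀) = radLim b z₀`. -/
def hbBoundaryKernel (b : ℂ → ℂ) (z₀ z : ℂ) : ℂ :=
  (1 - (starRingEnd ℂ) (radLim b z₀) * b z) / (1 - (starRingEnd ℂ) z₀ * z)

/-- `u` is a nontangential approach sequence to the boundary point `z₀`. -/
def NTApproach (u : ℕ → ℂ) (z₀ : ℂ) : Prop :=
  (∀ n, u n ∈ unitDisk) ∧ Filter.Tendsto u Filter.atTop (nhds z₀) ∧
    ∃ M : ℝ, ∀ n, ‖u n - z₀‖ ≤ M * (1 - ‖u n‖)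

/-- `b` has an angular derivative in the sense of Carathéodory at `z₀ ∈ ∂𝔻`. -/
def HasADC (b : ℂ → ℂ) (z₀ : ℂ) : Prop :=
  ‖radLim b z₀‖ = 1 ∧ ∃ L : ℂ, ∀ u : ℕ → ℂ, NTApproach u z₀ →
    Filter.Tendsto (fun n => b (u n)) Filter.atTop (nhds (radLim b z₀)) ∧
    Filter.Tendsto (fun n => (b (u n) - radLim b z₀) / (u n - z₀)) Filter.atTop (nhds L)


/-! ### Fourier analysis on the circle -/

lemma uc_ne_zero (θ : ℝ) : uc θ ≠ 0 := Complex.exp_ne_zero _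

lemma norm_uc (θ : ℝ) : ‖uc θ‖ = 1 := Complex.norm_exp_ofReal_mul_I θ

lemma conj_uc (θ : ℝ) : (starRingEnd ℂ) (uc θ) = (uc θ)⁻¹ := by
  rw [Complex.inv_def, Complex.normSq_eq_norm_sq, norm_uc]; simp

lemma continuous_uc : Continuous uc := by unfold uc; fun_prop

lemma uc_add (s t : ℝ) : uc (s + t) = uc s * uc t := by
  simp only [uc, ← Complex.exp_add]; push_cast; ring_nf

lemma uc_neg (t : ℝ) : uc (-t) = (uc t)⁻¹ := by
  simp [uc, ← Complex.exp_neg]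

lemma continuous_uc_zpow (n : ℤ) : Continuous fun θ => uc θ ^ n :=
  continuous_iff_continuousAt.2 fun θ =>
    continuous_uc.continuousAt.zpow₀ n (Or.inl (uc_ne_zero θ))

lemma norm_uc_zpow (θ : ℝ) (n : ℤ) : ‖uc θ ^ n‖ = 1 := by
  rw [norm_zpow, norm_uc, one_zpow]

lemma norm_ofReal_mul_uc {r : ℝ} (hr : 0 ≤ r) (θ : ℝ) : ‖(r : ℂ) * uc θ‖ = r := by
  rw [norm_mul, norm_uc, mul_one, Complex.norm_real, Real.norm_of_nonneg hr]

lemma mem_unitDisk {z : ℂ} : z ∈ unitDisk ↔ ‖z‖ < 1 := by simp [unitDisk]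

instance : IsFiniteMeasure bMeasure := by unfold bMeasure; infer_instance

lemma integral_bMeasure {E : Type*} [NormedAddCommGroup E] [NormedSpace ℝ E] (F : ℝ → E) :
    ∫ θ, F θ ∂bMeasure = ∫ θ in (0:ℝ)..(2 * Real.pi), F θ := by
  rw [intervalIntegral.integral_of_le Real.two_pi_pos.le, bMeasure]

/-- The `n`-th Fourier coefficient of a function on `(0, 2π]`. -/
def circCoeff (F : ℝ → ℂ) (n : ℤ) : ℂ :=
  (1 / (2 * (Real.pi : ℂ))) * ∫ θ, F θ * uc θ ^ (-n) ∂bMeasure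

instance fact_two_pi_pos : Fact (0 < 2 * Real.pi) := ⟨Real.two_pi_pos⟩

lemma fourier_two_pi (n : ℤ) (x : ℝ) :
    fourier n (x : AddCircle (2 * Real.pi)) = uc x ^ n := by
  rw [fourier_coe_apply, uc, ← Complex.exp_int_mul]
  congr 1
  have : (Real.pi : ℂ) ≠ 0 := by exact_mod_cast Real.pi_ne_zero
  push_cast
  field_simp

lemma circCoeff_eq_fourierCoeff (F : ℝ → ℂ) (n : ℤ) :
    circCoeff F n = fourierCoeff (AddCircle.liftIoc (2 * Real.pi) 0 F) n := by
  rw [fourierCoeff_eq_intervalIntegral _ _ 0, zero_add, circCoeff, integral_bMeasure,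
    Complex.real_smul]
  push_cast
  congr 1
  rw [intervalIntegral.integral_of_le Real.two_pi_pos.le,
    intervalIntegral.integral_of_le Real.two_pi_pos.le]
  refine setIntegral_congr_fun measurableSet_Ioc fun x hx => ?_
  have hx' : x ∈ Ioc (0 : ℝ) (0 + 2 * Real.pi) := by simpa using hx
  simp only [AddCircle.liftIoc_coe_apply hx', fourier_two_pi, smul_eq_mul]
  ring

lemma memLp_liftIoc_two_pi {F : ℝ → ℂ} (hF : MemLp F 2 bMeasure) :
    MemLp (AddCircle.liftIoc (2 * Real.pi) 0 F) 2 AddCircle.haarAddCircle := by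
  have h : MemLp F 2 (volume.restrict (Ioc 0 (0 + 2 * Real.pi))) := by simpa [bMeasure] using hF
  exact h.memLp_liftIoc.haarAddCircle

/-- Two square integrable functions with disjoint Fourier supports are orthogonal. -/
lemma integral_mul_conj_eq_zero {F G : ℝ → ℂ} (hF : MemLp F 2 bMeasure) (hG : MemLp G 2 bMeasure)
    (h : ∀ n, circCoeff F n = 0 ∨ circCoeff G n = 0) :
    ∫ θ, F θ * (starRingEnd ℂ) (G θ) ∂bMeasure = 0 := by
  have hF' := memLp_liftIoc_two_pi hF
  have hG' := memLp_liftIoc_two_pi hG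
  have key := fourierBasis.hasSum_inner_mul_inner hG'.toLp hF'.toLp
  have hz : ∀ i, inner ℂ hG'.toLp (fourierBasis i) * inner ℂ (fourierBasis i) hF'.toLp = 0 := by
    intro i
    rw [← fourierBasis.repr_apply_apply, ← inner_conj_symm, ← fourierBasis.repr_apply_apply,
      fourierBasis_repr, fourierBasis_repr, fourierCoeff_congr_ae hF'.coeFn_toLp,
      fourierCoeff_congr_ae hG'.coeFn_toLp, ← circCoeff_eq_fourierCoeff,
      ← circCoeff_eq_fourierCoeff]
    rcases h i with h | h <;> simp [h]
  simp only [hz] at key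
  have h0 : inner ℂ hG'.toLp hF'.toLp = 0 := key.unique hasSum_zero
  rw [L2.inner_def] at h0
  have h1 : ∫ x : AddCircle (2 * Real.pi), AddCircle.liftIoc (2 * Real.pi) 0
      (fun θ => F θ * (starRingEnd ℂ) (G θ)) x ∂AddCircle.haarAddCircle = 0 := by
    rw [← h0]
    refine integral_congr_ae ?_
    filter_upwards [hF'.coeFn_toLp, hG'.coeFn_toLp] with x h1 h2
    rw [h1, h2]
    simp only [RCLike.inner_apply]
    rfl
  rw [AddCircle.integral_haarAddCircle, AddCircle.integral_liftIoc_eq_intervalIntegral,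
    smul_eq_zero_iff_right (inv_ne_zero Real.two_pi_pos.ne'), zero_add] at h1
  rw [integral_bMeasure, h1]

/-- A square integrable function with vanishing Fourier coefficients is zero. -/
lemma ae_eq_zero_of_circCoeff {F : ℝ → ℂ} (hF : MemLp F 2 bMeasure)
    (h : ∀ n, circCoeff F n = 0) : F =ᵐ[bMeasure] 0 := by
  have h0 := integral_mul_conj_eq_zero hF hF fun n => Or.inl (h n)
  have h1 : ∫ θ, ‖F θ‖ ^ 2 ∂bMeasure = 0 := by
    have : ∀ θ, F θ * (starRingEnd ℂ) (F θ) = ((‖F θ‖ ^ 2 : ℝ) : ℂ) := fun θ => by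
      rw [Complex.mul_conj, Complex.normSq_eq_norm_sq]
    simp only [this, integral_complex_ofReal] at h0
    exact_mod_cast h0
  rw [integral_eq_zero_iff_of_nonneg (fun _ => by positivity)
    (hF.integrable_norm_pow (by norm_num))] at h1
  filter_upwards [h1] with θ hθ
  simpa using hθ

/-- Riesz–Fischer for one-sided sequences, with a `2π`-periodic representative. -/
lemma exists_periodic_circCoeff {a : ℕ → ℂ} (ha : Summable fun n => ‖a n‖ ^ 2) :
    ∃ F : ℝ → ℂ, MemLp F 2 bMeasure ∧ Function.Periodic F (2 * Real.pi) ∧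
      (∀ n : ℕ, circCoeff F n = a n) ∧ ∀ n : ℤ, n < 0 → circCoeff F n = 0 := by
  let b : ℤ → ℂ := fun n => if 0 ≤ n then a n.toNat else 0
  have hb : Memℓp b 2 := by
    apply memℓp_gen
    simp only [ENNReal.toReal_ofNat, Real.rpow_ofNat]
    have hinj : Function.Injective (fun n : ℕ => (n : ℤ)) := Nat.cast_injective
    refine (hinj.summable_iff ?_).1 ?_
    · intro x hx
      have : ¬ 0 ≤ x := fun h => hx ⟨x.toNat, by simpa using h⟩
      simp [b, this]
    · simpa [b, Function.comp_def] using ha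
  let f := (fourierBasis (T := 2 * Real.pi)).repr.symm ⟨b, hb⟩
  have hf : ∀ i, fourierCoeff f i = b i := fun i => by
    rw [← fourierBasis_repr]; simp [f]
  let F : ℝ → ℂ := fun x => f (x : AddCircle (2 * Real.pi))
  have hco : ∀ i, circCoeff F i = b i := fun i => by
    rw [← hf, fourierCoeff_eq_intervalIntegral _ _ 0, zero_add, circCoeff, integral_bMeasure,
      Complex.real_smul]
    push_cast
    congr 1
    refine intervalIntegral.integral_congr fun x _ => ?_
    simp only [fourier_two_pi, smul_eq_mul, F]
    ring
  refine ⟨F, ?_, ?_, ?_, ?_⟩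
  · have h1 : MemLp f 2 (volume : Measure (AddCircle (2 * Real.pi))) :=
      (Lp.memLp f).of_haarAddCircle
    have := h1.comp_measurePreserving (AddCircle.measurePreserving_mk (2 * Real.pi) 0)
    rw [zero_add] at this
    exact this
  · intro x
    simp only [F, AddCircle.coe_add_period]
  · intro n; rw [hco]; simp [b]
  · intro n hn; rw [hco]; simp [b, hn]

lemma circCoeff_congr {F G : ℝ → ℂ} (h : F =ᵐ[bMeasure] G) (n : ℤ) :
    circCoeff F n = circCoeff G n := by
  rw [circCoeff, circCoeff]
  congr 1
  refine integral_congr_ae ?_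
  filter_upwards [h] with θ hθ
  rw [hθ]

lemma integrable_mul_uc_zpow {F : ℝ → ℂ} (hF : Integrable F bMeasure) (n : ℤ) :
    Integrable (fun θ => F θ * uc θ ^ n) bMeasure :=
  hF.mul_bdd (c := 1) (continuous_uc_zpow n).aestronglyMeasurable
    (Eventually.of_forall fun θ => (norm_uc_zpow θ n).le)

lemma memLp_mul_uc_zpow {F : ℝ → ℂ} (hF : MemLp F 2 bMeasure) (n : ℤ) :
    MemLp (fun θ => F θ * uc θ ^ n) 2 bMeasure := by
  refine hF.of_le (hF.1.mul (continuous_uc_zpow n).aestronglyMeasurable)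
    (Eventually.of_forall fun θ => ?_)
  rw [norm_mul, norm_uc_zpow, mul_one]

lemma circCoeff_add {F G : ℝ → ℂ} (hF : Integrable F bMeasure) (hG : Integrable G bMeasure)
    (n : ℤ) : circCoeff (fun θ => F θ + G θ) n = circCoeff F n + circCoeff G n := by
  simp only [circCoeff, add_mul]
  rw [integral_add (integrable_mul_uc_zpow hF _) (integrable_mul_uc_zpow hG _), mul_add]

lemma circCoeff_const_mul (c : ℂ) (F : ℝ → ℂ) (n : ℤ) :
    circCoeff (fun θ => c * F θ) n = c * circCoeff F n := by
  simp only [circCoeff, mul_assoc, integral_const_mul]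
  ring

lemma circCoeff_sub {F G : ℝ → ℂ} (hF : Integrable F bMeasure) (hG : Integrable G bMeasure)
    (n : ℤ) : circCoeff (fun θ => F θ - G θ) n = circCoeff F n - circCoeff G n := by
  simp only [circCoeff, sub_mul]
  rw [integral_sub (integrable_mul_uc_zpow hF _) (integrable_mul_uc_zpow hG _), mul_sub]

lemma circCoeff_mul_uc_zpow (F : ℝ → ℂ) (k n : ℤ) :
    circCoeff (fun θ => F θ * uc θ ^ k) n = circCoeff F (n - k) := by
  simp only [circCoeff, mul_assoc, ← zpow_add₀ (uc_ne_zero _)]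
  congr 3
  ext θ
  congr 2
  ring

lemma circCoeff_conj (F : ℝ → ℂ) (n : ℤ) :
    circCoeff (fun θ => (starRingEnd ℂ) (F θ)) n = (starRingEnd ℂ) (circCoeff F (-n)) := by
  simp only [circCoeff, map_mul, ← integral_conj, map_zpow₀, conj_uc]
  congr 1
  · simp [Complex.conj_ofNat]
  · simp

lemma memLp_conj {F : ℝ → ℂ} (hF : MemLp F 2 bMeasure) :
    MemLp (fun θ => (starRingEnd ℂ) (F θ)) 2 bMeasure :=
  hF.star

/-- The product of two square integrable functions whose Fourier supports are opposite-disjoint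
has mean zero. -/
lemma integral_mul_eq_zero {F G : ℝ → ℂ} (hF : MemLp F 2 bMeasure) (hG : MemLp G 2 bMeasure)
    (h : ∀ n, circCoeff F n = 0 ∨ circCoeff G (-n) = 0) :
    ∫ θ, F θ * G θ ∂bMeasure = 0 := by
  have := integral_mul_conj_eq_zero hF (memLp_conj hG) fun n => by
    rw [circCoeff_conj, map_eq_zero]; exact h n
  simpa using this

lemma norm_mul_inv_uc (z : ℂ) (θ : ℝ) : ‖z * (uc θ)⁻¹‖ = ‖z‖ := by
  rw [norm_mul, norm_inv, norm_uc, inv_one, mul_one]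

/-- The Szegő projection as a power series. -/
lemma hasSum_szProj {F : ℝ → ℂ} (hF : Integrable F bMeasure) {z : ℂ} (hz : ‖z‖ < 1) :
    HasSum (fun n : ℕ => circCoeff F n * z ^ n) (szProj F z) := by
  have h : HasSum (fun n : ℕ => ∫ θ, F θ * (z * (uc θ)⁻¹) ^ n ∂bMeasure)
      (∫ θ, F θ * (1 - z * (uc θ)⁻¹)⁻¹ ∂bMeasure) := by
    have hs : Summable fun n : ℕ => ‖z‖ ^ n := summable_geometric_of_lt_one (norm_nonneg z) hz
    have hint : Integrable (fun θ => ∑' n : ℕ, ‖F θ‖ * ‖z‖ ^ n) bMeasure := by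
      have : (fun θ => ∑' n : ℕ, ‖F θ‖ * ‖z‖ ^ n) = fun θ => ‖F θ‖ * ∑' n : ℕ, ‖z‖ ^ n :=
        funext fun θ => tsum_mul_left
      rw [this]
      exact hF.norm.mul_const _
    have hmeas : ∀ n : ℕ, AEStronglyMeasurable (fun θ => F θ * (z * (uc θ)⁻¹) ^ n) bMeasure :=
      fun n => hF.1.mul (Continuous.aestronglyMeasurable
        ((continuous_const.mul (continuous_uc.inv₀ uc_ne_zero)).pow n))
    have hle : ∀ (n : ℕ) (θ : ℝ), ‖F θ * (z * (uc θ)⁻¹) ^ n‖ ≤ ‖F θ‖ * ‖z‖ ^ n := fun n θ => by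
      rw [norm_mul, norm_pow, norm_mul_inv_uc]
    have hsum : ∀ θ : ℝ, HasSum (fun n : ℕ => F θ * (z * (uc θ)⁻¹) ^ n)
        (F θ * (1 - z * (uc θ)⁻¹)⁻¹) := fun θ => by
      have h1 : ‖z * (uc θ)⁻¹‖ < 1 := by rwa [norm_mul_inv_uc]
      have h2 := hasSum_geometric_of_norm_lt_one h1
      exact h2.mul_left (F θ)
    exact hasSum_integral_of_dominated_convergence (fun (n : ℕ) θ => ‖F θ‖ * ‖z‖ ^ n) hmeas
      (fun n => ae_of_all _ (hle n)) (ae_of_all _ fun θ => hs.mul_left ‖F θ‖) hint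
      (ae_of_all _ hsum)
  have h2 : ∀ n : ℕ, circCoeff F n * z ^ n =
      (1 / (2 * (Real.pi : ℂ))) * ∫ θ, F θ * (z * (uc θ)⁻¹) ^ n ∂bMeasure := by
    intro n
    rw [circCoeff, mul_assoc, ← integral_mul_const]
    congr 2
    ext θ
    rw [mul_pow, zpow_neg, inv_pow, zpow_natCast]
    ring
  simp only [h2, szProj, ← integral_bMeasure]
  exact h.mul_left _

/-- Power series coefficients are determined by the sum on the unit disk. -/
lemma eq_of_hasSum_pow {c d : ℕ → ℂ} {f : ℂ → ℂ}
    (hc : ∀ z : ℂ, ‖z‖ < 1 → HasSum (fun n => c n * z ^ n) (f z))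
    (hd : ∀ z : ℂ, ‖z‖ < 1 → HasSum (fun n => d n * z ^ n) (f z)) : c = d := by
  have aux : ∀ e : ℕ → ℂ, (∀ z : ℂ, ‖z‖ < 1 → HasSum (fun n => e n * z ^ n) (f z)) →
      HasFPowerSeriesAt f (FormalMultilinearSeries.ofScalars ℂ e) 0 := by
    intro e he
    rw [hasFPowerSeriesAt_iff]
    filter_upwards [Metric.ball_mem_nhds (0 : ℂ) one_pos] with z hz
    simpa [mul_comm] using he z (by simpa using hz)
  have h := (aux c hc).eq_formalMultilinearSeries (aux d hd)
  ext n
  have := congrArg (fun p => FormalMultilinearSeries.coeff p n) h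
  simpa using this

lemma circCoeff_eq_zero_of_szProj {F : ℝ → ℂ} (hF : Integrable F bMeasure)
    (h : ∀ z ∈ unitDisk, szProj F z = 0) (n : ℕ) : circCoeff F n = 0 := by
  have := eq_of_hasSum_pow (c := fun n => circCoeff F n) (d := 0) (f := szProj F)
    (fun z hz => hasSum_szProj hF hz)
    (fun z hz => by rw [h z (mem_unitDisk.2 hz)]; simp)
  exact congrFun this n

lemma szProj_eq_zero {F : ℝ → ℂ} (hF : Integrable F bMeasure)
    (h : ∀ n : ℕ, circCoeff F n = 0) (z : ℂ) (hz : z ∈ unitDisk) : szProj F z = 0 := by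
  have := hasSum_szProj hF (mem_unitDisk.1 hz)
  simp only [h, zero_mul] at this
  exact this.unique hasSum_zero

/-- Boundary functions of Hardy class: square integrable, without negative frequencies. -/
def HardyBdry (F : ℝ → ℂ) : Prop :=
  MemLp F 2 bMeasure ∧ ∀ n : ℤ, n < 0 → circCoeff F n = 0

lemma HardyBdry.memLp {F : ℝ → ℂ} (hF : HardyBdry F) : MemLp F 2 bMeasure := hF.1

lemma HardyBdry.integrable {F : ℝ → ℂ} (hF : HardyBdry F) : Integrable F bMeasure :=
  hF.1.integrable (by norm_num)

lemma HardyBdry.congr {F G : ℝ → ℂ} (hF : HardyBdry F) (h : F =ᵐ[bMeasure] G) : HardyBdry G :=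
  ⟨(memLp_congr_ae h).1 hF.1, fun n hn => by rw [← circCoeff_congr h, hF.2 n hn]⟩

lemma HardyBdry.add {F G : ℝ → ℂ} (hF : HardyBdry F) (hG : HardyBdry G) :
    HardyBdry fun θ => F θ + G θ :=
  ⟨hF.1.add hG.1, fun n hn => by
    rw [circCoeff_add hF.integrable hG.integrable, hF.2 n hn, hG.2 n hn, add_zero]⟩

lemma HardyBdry.sub {F G : ℝ → ℂ} (hF : HardyBdry F) (hG : HardyBdry G) :
    HardyBdry fun θ => F θ - G θ :=
  ⟨hF.1.sub hG.1, fun n hn => by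
    rw [circCoeff_sub hF.integrable hG.integrable, hF.2 n hn, hG.2 n hn, sub_zero]⟩

lemma HardyBdry.const_mul {F : ℝ → ℂ} (c : ℂ) (hF : HardyBdry F) :
    HardyBdry fun θ => c * F θ :=
  ⟨hF.1.const_mul c, fun n hn => by rw [circCoeff_const_mul, hF.2 n hn, mul_zero]⟩

lemma HardyBdry.mul_uc_pow {F : ℝ → ℂ} (hF : HardyBdry F) (k : ℕ) :
    HardyBdry fun θ => F θ * uc θ ^ k :=
  ⟨by simpa using memLp_mul_uc_zpow hF.1 k, fun n hn => by
    simp only [← zpow_natCast]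
    rw [circCoeff_mul_uc_zpow, hF.2 _ (by omega)]⟩

/-- A product of two Hardy class boundary functions and a positive power of `e^{iθ}` has mean
zero. -/
lemma HardyBdry.integral_mul_uc {F G : ℝ → ℂ} (hF : HardyBdry F) (hG : HardyBdry G) (k : ℕ) :
    ∫ θ, F θ * (G θ * uc θ ^ (k + 1)) ∂bMeasure = 0 := by
  refine integral_mul_eq_zero hF.1 (hG.mul_uc_pow (k + 1)).1 fun n => ?_
  rcases lt_or_ge n 0 with hn | hn
  · exact Or.inl (hF.2 n hn)
  · right
    simp only [← zpow_natCast]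
    rw [circCoeff_mul_uc_zpow]
    exact hG.2 _ (by push_cast; omega)

/-- A square integrable product of Hardy class boundary functions is of Hardy class. -/
lemma HardyBdry.mul {F G : ℝ → ℂ} (hF : HardyBdry F) (hG : HardyBdry G)
    (h : MemLp (fun θ => F θ * G θ) 2 bMeasure) : HardyBdry fun θ => F θ * G θ := by
  refine ⟨h, fun n hn => ?_⟩
  obtain ⟨k, rfl⟩ : ∃ k : ℕ, n = -(k + 1) := ⟨(-n - 1).toNat, by omega⟩
  rw [circCoeff]
  have := hF.integral_mul_uc hG k
  simp only [← mul_assoc] at this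
  simp only [neg_neg]
  rw [mul_eq_zero]; right
  exact_mod_cast this

/-! ### The Poisson kernel and radial limits -/

/-- The Poisson kernel of the unit disk at the point `r`. -/
def poisson (r t : ℝ) : ℝ := (1 - r ^ 2) / (1 - 2 * r * Real.cos t + r ^ 2)

lemma poisson_denom_pos {r : ℝ} (hr : r ∈ Ico (0 : ℝ) 1) (t : ℝ) :
    0 < 1 - 2 * r * Real.cos t + r ^ 2 := by
  nlinarith [Real.cos_le_one t, hr.1, hr.2, sq_nonneg (1 - r),
    mul_nonneg hr.1 (sub_nonneg.2 (Real.cos_le_one t)), mul_pos (sub_pos.2 hr.2) (sub_pos.2 hr.2)]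

lemma poisson_eq {z : ℂ} (hz : ‖z‖ < 1) {w : ℂ} (hw : ‖w‖ = 1) :
    (1 - z * w⁻¹)⁻¹ + (starRingEnd ℂ) z * w / (1 - (starRingEnd ℂ) z * w) =
      ((1 - ‖z‖ ^ 2 : ℝ) : ℂ) / ((1 - 2 * (z * w⁻¹).re + ‖z‖ ^ 2 : ℝ) : ℂ) := by
  have hw0 : w ≠ 0 := by rintro rfl; simp at hw
  have h1 : 1 - z * w⁻¹ ≠ 0 := sub_ne_zero.2 fun h => by
    have := congrArg norm h
    simp [hw] at this; linarith
  have h2 : 1 - (starRingEnd ℂ) z * w ≠ 0 := sub_ne_zero.2 fun h => by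
    have := congrArg norm h
    simp [hw] at this; linarith
  have hinv : w⁻¹ = (starRingEnd ℂ) w := by
    rw [Complex.inv_def, Complex.normSq_eq_norm_sq, hw]; simp
  have hd : ((1 - 2 * (z * w⁻¹).re + ‖z‖ ^ 2 : ℝ) : ℂ) =
      (1 - z * w⁻¹) * (1 - (starRingEnd ℂ) z * w) := by
    have e1 : (((z * w⁻¹).re : ℝ) : ℂ) = (z * w⁻¹ + (starRingEnd ℂ) z * w) / 2 := by
      rw [Complex.re_eq_add_conj, hinv]; simp
    have e2 : ((‖z‖ ^ 2 : ℝ) : ℂ) = z * (starRingEnd ℂ) z := by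
      rw [Complex.mul_conj, Complex.normSq_eq_norm_sq]
    push_cast at e2 ⊢
    rw [e2, e1]
    field_simp
    ring
  rw [hd]
  have e2 : ((1 - ‖z‖ ^ 2 : ℝ) : ℂ) = 1 - z * (starRingEnd ℂ) z := by
    rw [Complex.mul_conj, Complex.normSq_eq_norm_sq]; push_cast; rfl
  have h3 : w - z ≠ 0 := by
    intro h; apply h1; rw [← sub_eq_zero.1 h, mul_inv_cancel₀ hw0, sub_self]
  have h4 : (1 - z * w⁻¹)⁻¹ = w / (w - z) := by
    rw [eq_div_iff h3, inv_mul_eq_iff_eq_mul₀ h1]; field_simp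
  have h5 : 1 - z * w⁻¹ = (w - z) / w := by field_simp
  rw [e2, h4, h5]
  generalize (starRingEnd ℂ) z = y at *
  rw [mul_comm y w] at h2 ⊢
  field_simp
  ring

/-- The Poisson integral representation on the unit circle. -/
lemma szProj_eq_integral_poissonKernel {F : ℝ → ℂ} (hF : HardyBdry F) {z : ℂ} (hz : ‖z‖ < 1) :
    szProj F z = (1 / (2 * (Real.pi : ℂ))) * ∫ s, F s *
      (((1 - ‖z‖ ^ 2) / (1 - 2 * (z * (uc s)⁻¹).re + ‖z‖ ^ 2) : ℝ) : ℂ) ∂bMeasure := by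
  have h0 : szProj (fun s => (starRingEnd ℂ) (F s) * uc s ^ (-1 : ℤ)) z = 0 := by
    refine szProj_eq_zero (integrable_mul_uc_zpow ((memLp_conj hF.1).integrable (by norm_num)) _)
      (fun n => ?_) z (mem_unitDisk.2 hz)
    rw [circCoeff_mul_uc_zpow, circCoeff_conj, hF.2 _ (by omega), map_zero]
  have hc : ∀ {c : ℂ}, ‖c‖ < 1 → ∀ s, 1 - c * uc s ≠ 0 := fun {c} hc s => sub_ne_zero.2 fun h => by
    have := congrArg norm h
    simp [norm_uc] at this; linarith
  have hc' : ∀ {c : ℂ}, ‖c‖ < 1 → ∀ s, 1 - c * (uc s)⁻¹ ≠ 0 := fun {c} hc s =>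
    sub_ne_zero.2 fun h => by
      have := congrArg norm h
      simp [norm_uc] at this; linarith
  have hz' : ‖(starRingEnd ℂ) z‖ < 1 := by simpa using hz
  have h1 : ∫ s, F s * ((starRingEnd ℂ) z * uc s / (1 - (starRingEnd ℂ) z * uc s)) ∂bMeasure
      = 0 := by
    rw [szProj, ← integral_bMeasure, mul_eq_zero] at h0
    have h0 := h0.resolve_left (by simp [Real.pi_ne_zero])
    have h0 := congrArg (fun x => (starRingEnd ℂ) z * (starRingEnd ℂ) x) h0
    simp only [← integral_conj, map_zero, mul_zero, ← integral_const_mul] at h0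
    rw [← h0]
    congr 1
    ext s
    simp only [map_mul, map_inv₀, map_sub, map_one, conj_uc, zpow_neg, zpow_one, Complex.conj_conj,
      inv_inv]
    have := hc hz' s
    field_simp
  have hcont : ∀ G : ℝ → ℂ, Continuous G → Integrable (fun s => F s * G s) bMeasure := by
    intro G hG
    obtain ⟨C, hC⟩ := (isCompact_Icc (a := (0:ℝ)) (b := 2 * Real.pi)).exists_bound_of_continuousOn
      (f := G) hG.continuousOn
    refine hF.integrable.mul_bdd (c := C) hG.aestronglyMeasurable ?_
    rw [bMeasure, ae_restrict_iff' measurableSet_Ioc]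
    exact ae_of_all _ fun s hs => hC s ⟨hs.1.le, hs.2⟩
  rw [szProj, ← integral_bMeasure]
  congr 1
  rw [← add_zero (∫ s, F s * _ ∂bMeasure), ← h1, ← integral_add]
  · congr 1
    ext s
    rw [← mul_add, poisson_eq hz (norm_uc s)]
    push_cast; rfl
  · exact hcont _ ((continuous_const.sub (continuous_const.mul
      (continuous_uc.inv₀ uc_ne_zero))).inv₀ (hc' hz))
  · exact hcont _ ((continuous_const.mul continuous_uc).div (continuous_const.sub
      (continuous_const.mul continuous_uc)) (hc hz'))

lemma szProj_eq_integral_poisson {F : ℝ → ℂ} (hF : HardyBdry F)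
    (hper : Function.Periodic F (2 * Real.pi)) {r : ℝ} (hr : r ∈ Ico (0 : ℝ) 1) (θ : ℝ) :
    szProj F (r * uc θ) =
      (1 / (2 * (Real.pi : ℂ))) * ∫ t in (-Real.pi)..Real.pi, F (θ + t) * (poisson r t : ℂ) := by
  have hz : ‖(r : ℂ) * uc θ‖ = r := norm_ofReal_mul_uc hr.1 θ
  rw [szProj_eq_integral_poissonKernel hF (by rw [hz]; exact hr.2), integral_bMeasure, hz]
  congr 1
  have e : ∀ s, (1 - r ^ 2) / (1 - 2 * ((r : ℂ) * uc θ * (uc s)⁻¹).re + r ^ 2) =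
      poisson r (s - θ) := by
    intro s
    rw [poisson, mul_assoc, ← uc_neg, ← uc_add, Complex.re_ofReal_mul, uc,
      Complex.exp_ofReal_mul_I_re,
      show θ + -s = -(s - θ) by ring, Real.cos_neg, mul_assoc]
  simp only [e]
  have hp : Function.Periodic (fun s => F s * (poisson r (s - θ) : ℂ)) (2 * Real.pi) := by
    intro s
    simp only [hper s]
    rw [show s + 2 * Real.pi - θ = (s - θ) + 2 * Real.pi by ring, poisson, Real.cos_add_two_pi]
    rfl
  have h1 := hp.intervalIntegral_add_eq 0 (θ + -Real.pi)
  rw [zero_add, show θ + -Real.pi + 2 * Real.pi = θ + Real.pi by ring] at h1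
  rw [h1, ← intervalIntegral.integral_comp_add_left]
  simp

lemma circCoeff_const (c : ℂ) (n : ℤ) : circCoeff (fun _ => c) n = if n = 0 then c else 0 := by
  have hpi : (Real.pi : ℂ) ≠ 0 := by exact_mod_cast Real.pi_ne_zero
  rw [circCoeff, integral_bMeasure]
  split_ifs with h
  · subst h
    simp
    field_simp
  · have hc : -(n : ℂ) * Complex.I ≠ 0 := by simp [h]
    have e : ∀ θ : ℝ, c * uc θ ^ (-n) = c * Complex.exp (-(n : ℂ) * Complex.I * θ) := by
      intro θ
      rw [uc, ← Complex.exp_int_mul]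
      congr 2
      push_cast; ring
    simp only [e]
    rw [intervalIntegral.integral_const_mul, integral_exp_mul_complex hc]
    have : Complex.exp (-(n : ℂ) * Complex.I * ((2 * Real.pi : ℝ) : ℂ)) = 1 := by
      rw [Complex.exp_eq_one_iff]
      exact ⟨-n, by push_cast; ring⟩
    rw [this]
    simp

lemma hardyBdry_const (c : ℂ) : HardyBdry fun _ => c :=
  ⟨memLp_const c, fun n hn => by rw [circCoeff_const, if_neg hn.ne]⟩

lemma szProj_const (c : ℂ) {z : ℂ} (hz : ‖z‖ < 1) : szProj (fun _ => c) z = c := by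
  have h := hasSum_szProj (hardyBdry_const c).integrable hz
  refine h.unique ?_
  convert hasSum_single 0 fun n hn => ?_ using 1
  · simp [circCoeff_const]
  · simp [circCoeff_const, hn]

lemma integral_poisson {r : ℝ} (hr : r ∈ Ico (0 : ℝ) 1) :
    ∫ t in (-Real.pi)..Real.pi, poisson r t = 2 * Real.pi := by
  have hpi : (Real.pi : ℂ) ≠ 0 := by exact_mod_cast Real.pi_ne_zero
  have h := szProj_eq_integral_poisson (hardyBdry_const 1) (fun _ => rfl) hr 0
  rw [szProj_const 1 (by rw [norm_ofReal_mul_uc hr.1]; exact hr.2)] at h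
  simp only [one_mul] at h
  rw [intervalIntegral.integral_ofReal] at h
  rw [← Complex.ofReal_inj]
  push_cast
  field_simp at h
  rw [← h]

lemma hasDerivAt_poisson {r : ℝ} (hr : r ∈ Ico (0 : ℝ) 1) (t : ℝ) :
    HasDerivAt (poisson r)
      (-((1 - r ^ 2) * (2 * r * Real.sin t) / (1 - 2 * r * Real.cos t + r ^ 2) ^ 2)) t := by
  have h1 : HasDerivAt (fun t => 1 - 2 * r * Real.cos t + r ^ 2) (2 * r * Real.sin t) t := by
    have := (((Real.hasDerivAt_cos t).const_mul (2 * r)).const_sub 1).add_const (r ^ 2)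
    exact this.congr_deriv (by ring)
  have := (hasDerivAt_const t (1 - r ^ 2)).fun_div h1 (poisson_denom_pos hr t).ne'
  exact this.congr_deriv (by ring)

lemma contDiff_poisson {r : ℝ} (hr : r ∈ Ico (0 : ℝ) 1) : ContDiff ℝ 1 (poisson r) :=
  contDiff_const.div (by fun_prop) fun t => ne_of_gt (poisson_denom_pos hr t)

/-- The kernel `-t P_r'(t)`. -/
def poissonPeak (r t : ℝ) : ℝ :=
  t * ((1 - r ^ 2) * (2 * r * Real.sin t) / (1 - 2 * r * Real.cos t + r ^ 2) ^ 2)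

lemma poissonPeak_nonneg {r : ℝ} (hr : r ∈ Ico (0 : ℝ) 1) {t : ℝ}
    (ht : t ∈ Icc (-Real.pi) Real.pi) : 0 ≤ poissonPeak r t := by
  have h1 : 0 ≤ t * Real.sin t := by
    rcases le_total 0 t with h | h
    · exact mul_nonneg h (Real.sin_nonneg_of_nonneg_of_le_pi h ht.2)
    · exact mul_nonneg_of_nonpos_of_nonpos h
        (Real.sin_nonpos_of_nonpos_of_neg_pi_le h ht.1)
  have h2 : 0 ≤ (1 - r ^ 2) * (2 * r) := mul_nonneg (by nlinarith [hr.1, hr.2]) (by linarith [hr.1])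
  rw [poissonPeak, show t * ((1 - r ^ 2) * (2 * r * Real.sin t) /
    (1 - 2 * r * Real.cos t + r ^ 2) ^ 2)
    = ((1 - r ^ 2) * (2 * r)) * (t * Real.sin t) / (1 - 2 * r * Real.cos t + r ^ 2) ^ 2 by ring]
  exact div_nonneg (mul_nonneg h2 h1) (sq_nonneg _)

lemma continuous_poissonPeak {r : ℝ} (hr : r ∈ Ico (0 : ℝ) 1) : Continuous (poissonPeak r) :=
  continuous_id.mul (Continuous.div (by fun_prop) (by fun_prop)
    fun t => pow_ne_zero 2 (ne_of_gt (poisson_denom_pos hr t)))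

/-- Integration by parts against the Poisson kernel. -/
lemma integral_mul_poisson_eq {F : ℝ → ℝ}
    (hF : IntervalIntegrable F volume (-Real.pi) Real.pi) {r : ℝ} (hr : r ∈ Ico (0 : ℝ) 1) :
    ∫ t in (-Real.pi)..Real.pi, F t * poisson r t =
      poisson r Real.pi * (∫ t in (-Real.pi)..Real.pi, F t) +
        ∫ t in (-Real.pi)..Real.pi,
          poissonPeak r t * dslope (fun t => ∫ s in (0:ℝ)..t, F s) 0 t := by
  set E : ℝ → ℝ := fun t => ∫ s in (0:ℝ)..t, F s with hEdef
  have h0 : (0:ℝ) ∈ uIcc (-Real.pi) Real.pi := by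
    rw [uIcc_of_le (by linarith [Real.pi_pos])]; constructor <;> linarith [Real.pi_pos]
  have hEac : AbsolutelyContinuousOnInterval E (-Real.pi) Real.pi :=
    hF.absolutelyContinuousOnInterval_intervalIntegral h0
  have hPac : AbsolutelyContinuousOnInterval (poisson r) (-Real.pi) Real.pi :=
    (contDiff_poisson hr).contDiffOn.absolutelyContinuousOnInterval
  have h1 := hPac.integral_mul_deriv_eq_deriv_mul hEac
  have h2 : ∫ t in (-Real.pi)..Real.pi, poisson r t * deriv E t =
      ∫ t in (-Real.pi)..Real.pi, F t * poisson r t := by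
    refine intervalIntegral.integral_congr_ae ?_
    filter_upwards [hF.ae_hasDerivAt_integral] with x hx hx'
    rw [(hx (uIoc_subset_uIcc hx') 0 h0).deriv, mul_comm]
  have hneg : poisson r (-Real.pi) = poisson r Real.pi := by simp [poisson]
  have h3 : E Real.pi - E (-Real.pi) = ∫ t in (-Real.pi)..Real.pi, F t := by
    have hi1 : IntervalIntegrable F volume 0 Real.pi :=
      hF.mono_set (uIcc_subset_uIcc h0 right_mem_uIcc)
    have hi2 : IntervalIntegrable F volume 0 (-Real.pi) :=
      hF.mono_set (uIcc_subset_uIcc h0 left_mem_uIcc)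
    exact intervalIntegral.integral_interval_sub_left hi1 hi2
  rw [h2] at h1
  rw [h1, hneg, ← mul_sub, h3, sub_eq_add_neg, ← intervalIntegral.integral_neg]
  congr 2
  ext t
  rw [(hasDerivAt_poisson hr t).deriv]
  have h4 : E t = t * dslope E 0 t := by
    have := sub_smul_dslope E 0 t
    simp only [sub_zero, smul_eq_mul] at this
    rw [this]; simp [hEdef]
  rw [h4, poissonPeak]
  ring

lemma tendsto_poisson_pi :
    Tendsto (fun r => poisson r Real.pi) (nhdsWithin 1 (Iio 1)) (nhds 0) := by
  have : ContinuousAt (fun r => poisson r Real.pi) 1 := by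
    unfold poisson
    refine ContinuousAt.div (by fun_prop) (by fun_prop) (by norm_num)
  have h := this.tendsto
  rw [show poisson 1 Real.pi = 0 by simp [poisson]] at h
  exact h.mono_left nhdsWithin_le_nhds

lemma eventually_mem_Ico : ∀ᶠ r in nhdsWithin (1:ℝ) (Iio 1), r ∈ Ico (0:ℝ) 1 := by
  filter_upwards [self_mem_nhdsWithin, nhdsWithin_le_nhds (Ioi_mem_nhds (zero_lt_one (α := ℝ)))]
    with r h1 h2 using ⟨le_of_lt h2, h1⟩

lemma tendsto_integral_poissonPeak :
    Tendsto (fun r => ∫ t in (-Real.pi)..Real.pi, poissonPeak r t) (nhdsWithin 1 (Iio 1))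
      (nhds (2 * Real.pi)) := by
  have h1 : ∀ᶠ r in nhdsWithin (1:ℝ) (Iio 1), 2 * Real.pi - poisson r Real.pi * (2 * Real.pi) =
      ∫ t in (-Real.pi)..Real.pi, poissonPeak r t := by
    filter_upwards [eventually_mem_Ico] with r hr
    have hE : HasDerivAt (fun t => ∫ s in (0:ℝ)..t, (1:ℝ)) 1 0 := by
      simpa using hasDerivAt_id' (0:ℝ)
    have h := integral_mul_poisson_eq (F := fun _ => 1) intervalIntegrable_const hr
    have hds : dslope (fun t => ∫ s in (0:ℝ)..t, (1:ℝ)) 0 = fun _ => 1 := by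
      ext t
      rcases eq_or_ne t 0 with rfl | ht
      · rw [dslope_same, hE.deriv]
      · rw [dslope_of_ne _ ht, slope_def_field]; simp [ht]
    rw [hds] at h
    simp only [one_mul, mul_one, integral_poisson hr, intervalIntegral.integral_const,
      smul_eq_mul] at h
    linarith
  refine Tendsto.congr' h1 ?_
  simpa using tendsto_const_nhds.sub (tendsto_poisson_pi.mul_const (2 * Real.pi))

lemma tendstoUniformlyOn_poissonPeak {u : Set ℝ} (hu : IsOpen u) (h0 : (0:ℝ) ∈ u) :
    TendstoUniformlyOn poissonPeak 0 (nhdsWithin 1 (Iio 1)) (Icc (-Real.pi) Real.pi \ u) := by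
  obtain ⟨δ, hδ, hball⟩ := Metric.isOpen_iff.1 hu 0 h0
  set d := min δ Real.pi with hd
  have hd0 : 0 < d := lt_min hδ Real.pi_pos
  set k := 1 - Real.cos d with hk
  have hk0 : 0 < k := by
    have : Real.cos d < Real.cos 0 :=
      Real.cos_lt_cos_of_nonneg_of_le_pi le_rfl (min_le_right _ _) hd0
    rw [Real.cos_zero] at this; linarith
  have hlim : Tendsto (fun r : ℝ => (1 - r ^ 2) * (2 * Real.pi / k ^ 2)) (nhdsWithin 1 (Iio 1))
      (nhds 0) := by
    have : Continuous fun r : ℝ => (1 - r ^ 2) * (2 * Real.pi / k ^ 2) := by fun_prop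
    have := (this.tendsto 1).mono_left (nhdsWithin_le_nhds (s := Iio 1))
    simpa using this
  rw [Metric.tendstoUniformlyOn_iff]
  intro ε hε
  filter_upwards [hlim.eventually (gt_mem_nhds hε), eventually_mem_Ico,
    nhdsWithin_le_nhds (Ioi_mem_nhds (show (1/2:ℝ) < 1 by norm_num))] with r h1 hr hr2 t ht
  have hr2 : 1 / 2 < r := hr2
  have ht1 : d ≤ |t| := by
    by_contra hlt
    push Not at hlt
    exact ht.2 (hball (by
      rw [Metric.mem_ball, Real.dist_eq, sub_zero]
      exact hlt.trans_le (min_le_left _ _)))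
  have hcos : Real.cos t ≤ Real.cos d := by
    rw [← Real.cos_abs t]
    exact Real.cos_le_cos_of_nonneg_of_le_pi hd0.le (abs_le.2 ⟨ht.1.1, ht.1.2⟩) ht1
  have hD : k ≤ 1 - 2 * r * Real.cos t + r ^ 2 := by
    have : 1 - Real.cos d ≤ 2 * r * (1 - Real.cos t) := by
      nlinarith [Real.cos_le_one d, Real.cos_le_one t]
    nlinarith [sq_nonneg (1 - r)]
  rw [Pi.zero_apply, dist_comm, Real.dist_eq, sub_zero, abs_of_nonneg (poissonPeak_nonneg hr ht.1)]
  refine lt_of_le_of_lt ?_ h1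
  have hr1 : 0 ≤ 1 - r ^ 2 := by nlinarith [hr.1, hr.2]
  have hts : t * Real.sin t ≤ Real.pi := by
    calc t * Real.sin t ≤ |t| * |Real.sin t| := by rw [← abs_mul]; exact le_abs_self _
      _ ≤ Real.pi * 1 := mul_le_mul (abs_le.2 ⟨ht.1.1, ht.1.2⟩) (Real.abs_sin_le_one t)
        (abs_nonneg _) Real.pi_pos.le
      _ = Real.pi := mul_one _
  have hts0 : 0 ≤ t * Real.sin t := by
    rcases le_total 0 t with h | h
    · exact mul_nonneg h (Real.sin_nonneg_of_nonneg_of_le_pi h ht.1.2)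
    · exact mul_nonneg_of_nonpos_of_nonpos h
        (Real.sin_nonpos_of_nonpos_of_neg_pi_le h ht.1.1)
  rw [poissonPeak, show t * ((1 - r ^ 2) * (2 * r * Real.sin t) /
    (1 - 2 * r * Real.cos t + r ^ 2) ^ 2)
    = (1 - r ^ 2) * (2 * r * (t * Real.sin t) / (1 - 2 * r * Real.cos t + r ^ 2) ^ 2) by ring]
  refine mul_le_mul_of_nonneg_left ?_ hr1
  refine div_le_div₀ (by positivity) ?_ (by positivity) (by gcongr)
  nlinarith [hr.1, hr.2]

/-- Fatou's theorem for the Poisson integral, at a point where the primitive is differentiable. -/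
lemma tendsto_integral_mul_poisson {F : ℝ → ℝ}
    (hF : IntervalIntegrable F volume (-Real.pi) Real.pi) {L : ℝ}
    (hE : HasDerivAt (fun t => ∫ s in (0:ℝ)..t, F s) L 0) :
    Tendsto (fun r => ∫ t in (-Real.pi)..Real.pi, F t * poisson r t) (nhdsWithin 1 (Iio 1))
      (nhds (2 * Real.pi * L)) := by
  have hpi := Real.pi_pos
  set E : ℝ → ℝ := fun t => ∫ s in (0:ℝ)..t, F s with hEdef
  have hle : -Real.pi ≤ Real.pi := by linarith
  have h0 : (0:ℝ) ∈ uIcc (-Real.pi) Real.pi := by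
    rw [uIcc_of_le hle]; constructor <;> linarith
  have hnhds : Icc (-Real.pi) Real.pi ∈ nhds (0:ℝ) := Icc_mem_nhds (by linarith) hpi
  have hcont : ContinuousOn (dslope E 0) (Icc (-Real.pi) Real.pi) := by
    rw [continuousOn_dslope hnhds]
    refine ⟨?_, hE.differentiableAt⟩
    rw [← uIcc_of_le hle]
    exact (hF.absolutelyContinuousOnInterval_intervalIntegral h0).continuousOn
  have hpeak := tendsto_setIntegral_peak_smul_of_integrableOn_of_tendsto (μ := volume)
    (s := Icc (-Real.pi) Real.pi) (t := Icc (-Real.pi) Real.pi) (x₀ := (0:ℝ))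
    (φ := fun r t => (2 * Real.pi)⁻¹ * poissonPeak r t) (l := nhdsWithin 1 (Iio 1))
    (g := dslope E 0) (a := L) measurableSet_Icc measurableSet_Icc Subset.rfl self_mem_nhdsWithin
    (by simp) ?_ ?_ ?_ ?_ (hcont.integrableOn_Icc) ?_
  · have hlim := (tendsto_poisson_pi.mul_const (∫ t in (-Real.pi)..Real.pi, F t)).add
      (hpeak.const_mul (2 * Real.pi))
    rw [zero_mul, zero_add] at hlim
    refine hlim.congr' ?_
    filter_upwards [eventually_mem_Ico] with r hr
    rw [integral_mul_poisson_eq hF hr,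
      intervalIntegral.integral_of_le hle (f := fun t => poissonPeak r t * _),
      ← integral_Icc_eq_integral_Ioc]
    simp only [smul_eq_mul, mul_assoc]
    rw [integral_const_mul, ← mul_assoc Real.pi, ← mul_assoc 2, ← mul_assoc 2,
      mul_inv_cancel₀ (by positivity), one_mul]
  · filter_upwards [eventually_mem_Ico] with r hr t ht
    exact mul_nonneg (by positivity) (poissonPeak_nonneg hr ht)
  · intro u hu h0
    have := tendstoUniformlyOn_poissonPeak hu h0
    rw [Metric.tendstoUniformlyOn_iff] at this ⊢
    intro ε hε
    filter_upwards [this (2 * Real.pi * ε) (by positivity)] with r h1 t ht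
    have h2 := h1 t ht
    simp only [Pi.zero_apply, dist_zero_left, norm_mul] at h2 ⊢
    rw [Real.norm_of_nonneg (by positivity : (0:ℝ) ≤ (2 * Real.pi)⁻¹),
      inv_mul_lt_iff₀ (by positivity)]
    exact h2
  · have := (tendsto_integral_poissonPeak).const_mul (2 * Real.pi)⁻¹
    rw [inv_mul_cancel₀ (by positivity)] at this
    refine this.congr fun r => ?_
    rw [integral_const_mul, intervalIntegral.integral_of_le hle, integral_Icc_eq_integral_Ioc]
  · filter_upwards [eventually_mem_Ico] with r hr
    exact ((continuous_poissonPeak hr).const_smul (2 * Real.pi)⁻¹).aestronglyMeasurable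
  · have := hcont 0 (mem_of_mem_nhds hnhds)
    rw [ContinuousWithinAt, dslope_same, hE.deriv] at this
    exact this

lemma locallyIntegrable_of_periodic {F : ℝ → ℂ} (hF : Integrable F bMeasure)
    (hper : Function.Periodic F (2 * Real.pi)) : LocallyIntegrable F volume := by
  have h1 : IntervalIntegrable F volume 0 (2 * Real.pi) := by
    rw [intervalIntegrable_iff_integrableOn_Ioc_of_le Real.two_pi_pos.le]; exact hF
  intro x
  refine ⟨Ioc (x - 1) (x + 1), Ioc_mem_nhds (by linarith) (by linarith), ?_⟩
  rw [← intervalIntegrable_iff_integrableOn_Ioc_of_le (by linarith)]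
  exact hper.intervalIntegrable₀ Real.two_pi_pos.ne' h1 _ _

/-- Fatou's theorem for functions with one-sided spectrum. -/
lemma ae_tendsto_szProj {F : ℝ → ℂ} (hF : HardyBdry F)
    (hper : Function.Periodic F (2 * Real.pi)) :
    ∀ᵐ θ : ℝ, Tendsto (fun r : ℝ => szProj F (r * uc θ)) (nhdsWithin 1 (Iio 1)) (nhds (F θ)) := by
  have hloc := locallyIntegrable_of_periodic hF.integrable hper
  have hint : ∀ x y, IntervalIntegrable F volume x y := fun x y =>
    intervalIntegrable_iff.2
      ((hloc.integrableOn_isCompact isCompact_uIcc).mono_set uIoc_subset_uIcc)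
  filter_upwards [LocallyIntegrable.ae_hasDerivAt_integral hloc] with θ hθ
  have hint' : ∀ x y, IntervalIntegrable (fun t => F (θ + t)) volume x y := fun x y => by
    have := (hint (θ + x) (θ + y)).comp_add_left (c := θ)
    simpa using this
  have hE : HasDerivAt (fun t => ∫ s in (0:ℝ)..t, F (θ + s)) (F θ) 0 := by
    have h := hθ θ
    have h2 : HasDerivAt (fun t : ℝ => θ + t) 1 0 := by
      simpa using (hasDerivAt_id' (0:ℝ)).const_add θ
    have h3 := HasDerivAt.scomp (h := fun t : ℝ => θ + t) 0 (by simpa using h) h2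
    simp only [one_smul] at h3
    refine h3.congr_of_eventuallyEq (Eventually.of_forall fun t => ?_)
    simp
  have hre : HasDerivAt (fun t => ∫ s in (0:ℝ)..t, (F (θ + s)).re) (F θ).re 0 := by
    have h : HasDerivAt (fun t => Complex.reCLM (∫ s in (0:ℝ)..t, F (θ + s)))
      (Complex.reCLM (F θ)) 0 := Complex.reCLM.hasFDerivAt.comp_hasDerivAt 0 hE
    refine h.congr_of_eventuallyEq (Eventually.of_forall fun t => ?_)
    exact Complex.reCLM.intervalIntegral_comp_comm (hint' 0 t)
  have him : HasDerivAt (fun t => ∫ s in (0:ℝ)..t, (F (θ + s)).im) (F θ).im 0 := by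
    have h : HasDerivAt (fun t => Complex.imCLM (∫ s in (0:ℝ)..t, F (θ + s)))
      (Complex.imCLM (F θ)) 0 := Complex.imCLM.hasFDerivAt.comp_hasDerivAt 0 hE
    refine h.congr_of_eventuallyEq (Eventually.of_forall fun t => ?_)
    exact Complex.imCLM.intervalIntegral_comp_comm (hint' 0 t)
  have hreI : IntervalIntegrable (fun t => (F (θ + t)).re) volume (-Real.pi) Real.pi :=
    ⟨(hint' _ _).1.re, (hint' _ _).2.re⟩
  have himI : IntervalIntegrable (fun t => (F (θ + t)).im) volume (-Real.pi) Real.pi :=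
    ⟨(hint' _ _).1.im, (hint' _ _).2.im⟩
  have t1 := tendsto_integral_mul_poisson hreI hre
  have t2 := tendsto_integral_mul_poisson himI him
  have t3 := (((Complex.continuous_ofReal.tendsto _).comp t1).add
    (((Complex.continuous_ofReal.tendsto _).comp t2).mul_const Complex.I)).const_mul
      (1 / (2 * (Real.pi : ℂ)))
  have hpi : (Real.pi : ℂ) ≠ 0 := by exact_mod_cast Real.pi_ne_zero
  have e : (1 / (2 * (Real.pi : ℂ))) * (((2 * Real.pi * (F θ).re : ℝ) : ℂ) +
      ((2 * Real.pi * (F θ).im : ℝ) : ℂ) * Complex.I) = F θ := by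
    conv_rhs => rw [← Complex.re_add_im (F θ)]
    push_cast
    field_simp
  rw [e] at t3
  refine t3.congr' ?_
  filter_upwards [eventually_mem_Ico] with r hr
  have hP : ContinuousOn (poisson r) (uIcc (-Real.pi) Real.pi) :=
    (contDiff_poisson hr).continuous.continuousOn
  rw [szProj_eq_integral_poisson hF hper hr]
  congr 1
  simp only [Function.comp_apply]
  rw [← intervalIntegral.integral_ofReal, ← intervalIntegral.integral_ofReal,
    ← intervalIntegral.integral_mul_const, ← intervalIntegral.integral_add]
  · congr 1
    ext t
    conv_rhs => rw [← Complex.re_add_im (F (θ + t))]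
    push_cast
    ring
  · have h := hreI.mul_continuousOn hP
    exact ⟨h.1.ofReal, h.2.ofReal⟩
  · have h := himI.mul_continuousOn hP
    exact IntervalIntegrable.mul_const ⟨h.1.ofReal, h.2.ofReal⟩ _

lemma hasSum_sq_circCoeff {F : ℝ → ℂ} (hF : MemLp F 2 bMeasure) :
    HasSum (fun n : ℤ => ‖circCoeff F n‖ ^ 2) ((2 * Real.pi)⁻¹ * ∫ θ, ‖F θ‖ ^ 2 ∂bMeasure) := by
  have h := hasSum_sq_fourierCoeffOn Real.two_pi_pos hF
  have e : ∀ n, fourierCoeffOn Real.two_pi_pos F n = circCoeff F n := by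
    intro n
    rw [fourierCoeffOn_eq_integral, circCoeff, integral_bMeasure, Complex.real_smul]
    congr 1
    · push_cast; simp
    · congr 1
      ext x
      rw [fourier_coe_apply, uc, ← Complex.exp_int_mul, smul_eq_mul, mul_comm]
      congr 2
      have : (Real.pi : ℂ) ≠ 0 := by exact_mod_cast Real.pi_ne_zero
      push_cast
      field_simp
      ring
  simp only [e, sub_zero, smul_eq_mul] at h
  rwa [integral_bMeasure]

/-- The Taylor coefficients at the origin. -/
def taylorCoeff (h : ℂ → ℂ) (n : ℕ) : ℂ := ((n.factorial : ℂ))⁻¹ * iteratedDeriv n h 0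

lemma hasSum_taylorCoeff {h : ℂ → ℂ} (hh : DifferentiableOn ℂ h unitDisk) {z : ℂ} (hz : ‖z‖ < 1) :
    HasSum (fun n => taylorCoeff h n * z ^ n) (h z) := by
  have := Complex.hasSum_taylorSeries_on_ball (c := 0) (r := 1) hh (z := z) (by simpa using hz)
  simpa [taylorCoeff, mul_comm, mul_left_comm] using this

/-- A power series with square summable coefficients has a boundary function. -/
lemma exists_hardyBdry_of_summable {h : ℂ → ℂ} {a : ℕ → ℂ} (ha : Summable fun n => ‖a n‖ ^ 2)
    (hs : ∀ z : ℂ, ‖z‖ < 1 → HasSum (fun n => a n * z ^ n) (h z)) :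
    ∃ F : ℝ → ℂ, HardyBdry F ∧ (∀ n : ℕ, circCoeff F n = a n) ∧
      (∀ z : ℂ, ‖z‖ < 1 → h z = szProj F z) ∧
      ∀ᵐ θ : ℝ, Tendsto (fun r : ℝ => h (r * uc θ)) (nhdsWithin 1 (Iio 1)) (nhds (F θ)) := by
  obtain ⟨F, hF2, hper, hpos, hneg⟩ := exists_periodic_circCoeff ha
  have hF : HardyBdry F := ⟨hF2, hneg⟩
  have e : ∀ z : ℂ, ‖z‖ < 1 → h z = szProj F z := fun z hz =>
    (hs z hz).unique (by simpa only [hpos] using hasSum_szProj hF.integrable hz)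
  refine ⟨F, hF, hpos, e, ?_⟩
  filter_upwards [ae_tendsto_szProj hF hper] with θ hθ
  refine hθ.congr' ?_
  filter_upwards [eventually_mem_Ico] with r hr
  exact (e _ (by rw [norm_ofReal_mul_uc hr.1]; exact hr.2)).symm

lemma ae_bMeasure {p : ℝ → Prop} (h : ∀ᵐ θ : ℝ, p θ) : ∀ᵐ θ ∂bMeasure, p θ := ae_restrict_of_ae h

lemma MemH2.summable_taylorCoeff {h : ℂ → ℂ} (hh : MemH2 h) :
    Summable fun n => ‖taylorCoeff h n‖ ^ 2 := by
  obtain ⟨hd, C, hC⟩ := hh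
  have key : ∀ r ∈ Ioo (0:ℝ) 1, ∀ s : Finset ℕ,
      ∑ n ∈ s, ‖taylorCoeff h n‖ ^ 2 * r ^ (2 * n) ≤ (2 * Real.pi)⁻¹ * C := by
    intro r hr s
    have hb : ∀ z : ℂ, ‖z‖ < 1 → ‖(r : ℂ) * z‖ < 1 := fun z hz => by
      rw [norm_mul, Complex.norm_of_nonneg hr.1.le]
      nlinarith [hr.1, hr.2, norm_nonneg z]
    have hsr : ∀ z : ℂ, ‖z‖ < 1 →
        HasSum (fun n => (taylorCoeff h n * r ^ n) * z ^ n) (h (r * z)) := fun z hz => by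
      have := hasSum_taylorCoeff hd (hb z hz)
      simpa only [mul_pow, mul_assoc] using this
    have hsum : Summable fun n => ‖taylorCoeff h n * (r : ℂ) ^ n‖ ^ 2 := by
      have h1 := (hasSum_taylorCoeff hd (z := r) (by
        rw [Complex.norm_of_nonneg hr.1.le]; exact hr.2)).summable.norm
      refine Summable.of_norm_bounded_eventually_nat h1 ?_
      filter_upwards [h1.tendsto_atTop_zero.eventually (gt_mem_nhds zero_lt_one)] with n hn
      rw [Real.norm_of_nonneg (by positivity)]
      nlinarith [norm_nonneg (taylorCoeff h n * (r : ℂ) ^ n)]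
    obtain ⟨F, hF, hco, -, hlim⟩ := exists_hardyBdry_of_summable hsum hsr
    have hae : ∀ᵐ θ ∂bMeasure, F θ = h (r * uc θ) := by
      filter_upwards [ae_bMeasure hlim] with θ hθ
      refine tendsto_nhds_unique hθ ?_
      have hc : ContinuousAt h ((r : ℂ) * uc θ) :=
        (hd.differentiableAt (Metric.isOpen_ball.mem_nhds (mem_unitDisk.2 (by
          rw [norm_ofReal_mul_uc hr.1.le]; exact hr.2)))).continuousAt
      have hc2 : ContinuousAt (fun s : ℝ => h (r * (s * uc θ))) 1 := by
        refine ContinuousAt.comp (g := h) (by simpa using hc) ?_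
        fun_prop
      have := hc2.tendsto
      simp only [Complex.ofReal_one, one_mul] at this
      exact this.mono_left nhdsWithin_le_nhds
    have hP := hasSum_sq_circCoeff hF.1
    have h1 : (2 * Real.pi)⁻¹ * ∫ θ, ‖F θ‖ ^ 2 ∂bMeasure ≤ (2 * Real.pi)⁻¹ * C := by
      refine mul_le_mul_of_nonneg_left ?_ (by positivity)
      rw [integral_congr_ae (g := fun θ => ‖h (r * uc θ)‖ ^ 2)
        (by filter_upwards [hae] with θ hθ; rw [hθ]), integral_bMeasure]
      exact hC r ⟨hr.1.le, hr.2⟩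
    refine le_trans ?_ h1
    have h2 := sum_le_hasSum (s.map ⟨fun n : ℕ => (n : ℤ), Nat.cast_injective⟩)
      (fun _ _ => by positivity) hP
    rw [Finset.sum_map] at h2
    refine le_trans (le_of_eq ?_) h2
    refine Finset.sum_congr rfl fun n _ => ?_
    simp only [Function.Embedding.coeFn_mk, hco, norm_mul, norm_pow,
      Complex.norm_of_nonneg hr.1.le]
    rw [mul_pow, ← pow_mul, mul_comm n 2]
  refine summable_of_sum_le (c := (2 * Real.pi)⁻¹ * C) (fun _ => by positivity) fun s => ?_
  have hcont : Continuous fun r : ℝ => ∑ n ∈ s, ‖taylorCoeff h n‖ ^ 2 * r ^ (2 * n) := by fun_prop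
  have ht := (hcont.tendsto 1).mono_left (nhdsWithin_le_nhds (s := Iio 1))
  simp only [one_pow, mul_one] at ht
  refine le_of_tendsto ht ?_
  filter_upwards [self_mem_nhdsWithin, nhdsWithin_le_nhds (Ioi_mem_nhds (zero_lt_one (α := ℝ)))]
    with r h1 h2 using key r ⟨h2, h1⟩ s

lemma MemH2.exists_hardyBdry {h : ℂ → ℂ} (hh : MemH2 h) :
    ∃ F : ℝ → ℂ, HardyBdry F ∧ (∀ z : ℂ, ‖z‖ < 1 → h z = szProj F z) ∧
      ∀ᵐ θ : ℝ, Tendsto (fun r : ℝ => h (r * uc θ)) (nhdsWithin 1 (Iio 1)) (nhds (F θ)) := by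
  obtain ⟨F, h1, -, h2, h3⟩ := exists_hardyBdry_of_summable hh.summable_taylorCoeff
    fun z hz => hasSum_taylorCoeff hh.1 hz
  exact ⟨F, h1, h2, h3⟩

lemma bdry_eq_of_tendsto {h : ℂ → ℂ} {θ : ℝ} {L : ℂ}
    (hL : Tendsto (fun r : ℝ => h (r * uc θ)) (nhdsWithin 1 (Iio 1)) (nhds L)) : bdry h θ = L :=
  hL.limUnder_eq

/-- Fatou's theorem for `H²`. -/
lemma MemH2.ae_tendsto_bdry {h : ℂ → ℂ} (hh : MemH2 h) :
    ∀ᵐ θ ∂bMeasure, Tendsto (fun r : ℝ => h (r * uc θ)) (nhdsWithin 1 (Iio 1))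
      (nhds (bdry h θ)) := by
  obtain ⟨F, -, -, h3⟩ := hh.exists_hardyBdry
  filter_upwards [ae_bMeasure h3] with θ hθ
  rwa [bdry_eq_of_tendsto hθ]

lemma MemH2.hardyBdry {h : ℂ → ℂ} (hh : MemH2 h) : HardyBdry (bdry h) := by
  obtain ⟨F, h1, -, h3⟩ := hh.exists_hardyBdry
  refine h1.congr ?_
  filter_upwards [ae_bMeasure h3] with θ hθ
  rw [bdry_eq_of_tendsto hθ]

lemma MemH2.eq_szProj {h : ℂ → ℂ} (hh : MemH2 h) {z : ℂ} (hz : ‖z‖ < 1) :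
    h z = szProj (bdry h) z := by
  obtain ⟨F, h1, h2, h3⟩ := hh.exists_hardyBdry
  rw [h2 z hz, szProj, szProj, ← integral_bMeasure, ← integral_bMeasure]
  congr 1
  refine integral_congr_ae ?_
  filter_upwards [ae_bMeasure h3] with θ hθ
  rw [bdry_eq_of_tendsto hθ]

lemma MemH2.circCoeff_zero {h : ℂ → ℂ} (hh : MemH2 h) : circCoeff (bdry h) 0 = h 0 := by
  rw [hh.eq_szProj (z := 0) (by simp), szProj, circCoeff, integral_bMeasure]
  simp

/-- Functions in `H²` are determined by their boundary values. -/
lemma MemH2.eq_of_bdry {h g : ℂ → ℂ} (hh : MemH2 h) (hg : MemH2 g)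
    (e : bdry h =ᵐ[bMeasure] bdry g) {z : ℂ} (hz : ‖z‖ < 1) : h z = g z := by
  rw [hh.eq_szProj hz, hg.eq_szProj hz, szProj, szProj, ← integral_bMeasure, ← integral_bMeasure]
  congr 1
  refine integral_congr_ae ?_
  filter_upwards [e] with θ hθ
  rw [hθ]

lemma bdry_congr {h g : ℂ → ℂ} (e : ∀ z ∈ unitDisk, h z = g z) : bdry h = bdry g := by
  ext θ
  rw [bdry, bdry, radLim, radLim, limUnder, limUnder]
  congr 1
  refine Filter.map_congr ?_
  filter_upwards [eventually_mem_Ico] with r hr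
  exact e _ (mem_unitDisk.2 (by rw [norm_ofReal_mul_uc hr.1]; exact hr.2))

lemma MemH2.congr {h g : ℂ → ℂ} (hg : MemH2 g) (e : ∀ z ∈ unitDisk, h z = g z) : MemH2 h := by
  obtain ⟨hd, C, hC⟩ := hg
  refine ⟨hd.congr e, C, fun r hr => ?_⟩
  have he : ∀ θ, h (r * uc θ) = g (r * uc θ) := fun θ =>
    e _ (mem_unitDisk.2 (by rw [norm_ofReal_mul_uc hr.1]; exact hr.2))
  simp only [he]
  exact hC r hr

/-! ### Blaschke products with zeros in `(-1, 0)` -/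

lemma MemH2.of_bounded {h : ℂ → ℂ} (hd : DifferentiableOn ℂ h unitDisk) {C : ℝ}
    (hC : ∀ z ∈ unitDisk, ‖h z‖ ≤ C) : MemH2 h := by
  refine ⟨hd, C ^ 2 * (2 * Real.pi), fun r hr => ?_⟩
  have hm : ∀ θ, (r : ℂ) * uc θ ∈ unitDisk := fun θ =>
    mem_unitDisk.2 (by rw [norm_ofReal_mul_uc hr.1]; exact hr.2)
  have hcont : Continuous fun θ : ℝ => ‖h (r * uc θ)‖ ^ 2 := by
    have : Continuous fun θ : ℝ => h (r * uc θ) :=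
      hd.continuousOn.comp_continuous (continuous_const.mul continuous_uc) hm
    exact this.norm.pow 2
  have := intervalIntegral.integral_mono_on (μ := volume) (a := 0) (b := 2 * Real.pi)
    (g := fun _ => C ^ 2) (by positivity) (hcont.intervalIntegrable _ _)
    intervalIntegrable_const (fun θ _ => pow_le_pow_left₀ (norm_nonneg _) (hC _ (hm θ)) 2)
  refine this.trans (le_of_eq ?_)
  simp
  ring

lemma ae_uc_ne_neg_one : ∀ᵐ θ : ℝ, uc θ ≠ -1 := by
  have hc : {θ : ℝ | uc θ = -1} ⊆ range fun n : ℤ => Real.pi + n * (2 * Real.pi) := by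
    intro θ hθ
    have h1 : Complex.exp (θ * Complex.I) = Complex.exp (Real.pi * Complex.I) := by
      rw [Complex.exp_pi_mul_I]; exact hθ
    obtain ⟨n, hn⟩ := Complex.exp_eq_exp_iff_exists_int.1 h1
    refine ⟨n, ?_⟩
    have h2 : ((Real.pi + n * (2 * Real.pi) : ℝ) : ℂ) * Complex.I = θ * Complex.I := by
      rw [hn]; push_cast; ring
    exact_mod_cast mul_right_cancel₀ Complex.I_ne_zero h2
  have := ((countable_range _).mono hc).measure_zero volume
  simpa [ae_iff] using this

lemma norm_one_add_le_two_mul {r : ℝ} (hr : r ∈ Ioo (-1 : ℝ) 0) {z : ℂ} (hz : ‖z‖ ≤ 1) :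
    ‖1 + z‖ ≤ 2 * ‖1 - r * z‖ := by
  have h1 : (1 : ℂ) + z = (1 - r * z) + (1 + r) * z := by ring
  have h2 : ‖(1 + (r : ℂ)) * z‖ ≤ 1 + r := by
    have : ‖(1 + (r : ℂ))‖ = 1 + r := by
      rw [← Complex.ofReal_one, ← Complex.ofReal_add, Complex.norm_of_nonneg (by linarith [hr.1])]
    rw [norm_mul, this]
    nlinarith [hr.1]
  have h3 : ‖(r : ℂ) * z‖ ≤ -r := by
    rw [norm_mul, Complex.norm_real, Real.norm_of_nonpos hr.2.le]
    nlinarith [hr.2]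
  have h4 : 1 + r ≤ ‖1 - r * z‖ := by
    have := norm_sub_norm_le (1 : ℂ) (r * z)
    rw [norm_one] at this
    linarith
  calc ‖1 + z‖ ≤ ‖1 - r * z‖ + ‖(1 + (r : ℂ)) * z‖ := by rw [h1]; exact norm_add_le _ _
    _ ≤ _ := by linarith

lemma one_sub_mul_ne_zero {r : ℝ} (hr : r ∈ Ioo (-1 : ℝ) 0) {z : ℂ} (hz : ‖z‖ ≤ 1) :
    (1 : ℂ) - r * z ≠ 0 := by
  intro h
  have h1 : (1 : ℂ) = r * z := by linear_combination h
  have h2 : (1 : ℝ) = |r| * ‖z‖ := by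
    have := congrArg norm h1
    rwa [norm_one, norm_mul, Complex.norm_real, Real.norm_eq_abs] at this
  rw [abs_of_neg hr.2] at h2
  nlinarith [hr.1, hr.2, norm_nonneg z]

lemma norm_sub_sq_add (r : ℝ) (z : ℂ) :
    ‖1 - r * z‖ ^ 2 = ‖z - r‖ ^ 2 + (1 - r ^ 2) * (1 - ‖z‖ ^ 2) := by
  simp only [← Complex.normSq_eq_norm_sq, Complex.normSq_apply, Complex.sub_re, Complex.sub_im,
    Complex.mul_re, Complex.mul_im, Complex.ofReal_re, Complex.ofReal_im, Complex.one_re,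
    Complex.one_im]
  ring

lemma norm_blaschke_le {r : ℝ} (hr : r ∈ Ioo (-1 : ℝ) 0) {z : ℂ} (hz : ‖z‖ ≤ 1) :
    ‖(z - r) / (1 - r * z)‖ ≤ 1 := by
  rw [norm_div]
  refine div_le_one_of_le₀ ?_ (norm_nonneg _)
  have := norm_sub_sq_add r z
  refine le_of_sq_le_sq ?_ (norm_nonneg _) 
  have h1 : 0 ≤ 1 - r ^ 2 := by nlinarith [hr.1, hr.2]
  have h2 : 0 ≤ 1 - ‖z‖ ^ 2 := by nlinarith [norm_nonneg z]
  nlinarith [mul_nonneg h1 h2]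

lemma norm_blaschke_eq {r : ℝ} (hr : r ∈ Ioo (-1 : ℝ) 0) {z : ℂ} (hz : ‖z‖ = 1) :
    ‖(z - r) / (1 - r * z)‖ = 1 := by
  have h := norm_sub_sq_add r z
  rw [hz] at h
  have h0 : ‖1 - r * z‖ ≠ 0 := norm_ne_zero_iff.2 (one_sub_mul_ne_zero hr hz.le)
  rw [norm_div, div_eq_one_iff_eq h0, ← sq_eq_sq₀ (norm_nonneg _) (norm_nonneg _), h]
  ring

/-- The infinite product with zeros `r n`. -/
def blaschkeProd (r : ℕ → ℝ) (z : ℂ) : ℂ := ∏' n, ((z - (r n : ℂ)) / (1 - (r n : ℂ) * z))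

lemma hasProdUniformlyOn_blaschke {r : ℕ → ℝ} (hr : ∀ n, r n ∈ Ioo (-1 : ℝ) 0)
    (hs : Summable fun n => 1 + r n) {δ : ℝ} (hδ : 0 < δ) :
    HasProdUniformlyOn (fun n z => (z - (r n : ℂ)) / (1 - (r n : ℂ) * z)) (blaschkeProd r)
      (Metric.closedBall 0 1 ∩ {z | δ ≤ ‖1 + z‖}) := by
  set K : Set ℂ := Metric.closedBall 0 1 ∩ {z | δ ≤ ‖1 + z‖}
  have hK : IsCompact K := (isCompact_closedBall _ _).inter_right
    (isClosed_le continuous_const (by fun_prop))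
  have hK1 : ∀ z ∈ K, ‖z‖ ≤ 1 := fun z hz => by simpa using hz.1
  have hcts : ∀ n, ContinuousOn (fun z : ℂ => -((1 + r n) * (1 - z) / (1 - r n * z))) K := by
    intro n
    refine ContinuousOn.neg (ContinuousOn.div (by fun_prop) (by fun_prop) fun z hz => ?_)
    exact one_sub_mul_ne_zero (hr n) (hK1 z hz)
  have hb : ∀ n, ∀ z ∈ K, ‖-((1 + r n) * (1 - z) / (1 - r n * z))‖ ≤ 4 / δ * (1 + r n) := by
    intro n z hz
    have h1 : ‖(1 + (r n : ℂ))‖ = 1 + r n := by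
      rw [← Complex.ofReal_one, ← Complex.ofReal_add,
        Complex.norm_of_nonneg (by linarith [(hr n).1])]
    have h2 : ‖1 - z‖ ≤ 2 := (norm_sub_le _ _).trans (by rw [norm_one]; linarith [hK1 z hz])
    have h3 : δ / 2 ≤ ‖1 - r n * z‖ := by
      have := norm_one_add_le_two_mul (hr n) (hK1 z hz)
      have h4 : δ ≤ ‖1 + z‖ := hz.2
      linarith
    rw [norm_neg, norm_div, norm_mul, h1, div_le_iff₀ (by linarith)]
    have h5 : 0 ≤ 1 + r n := by linarith [(hr n).1]
    calc (1 + r n) * ‖1 - z‖ ≤ (1 + r n) * 2 := by gcongr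
      _ = 4 / δ * (1 + r n) * (δ / 2) := by field_simp; norm_num
      _ ≤ _ := by gcongr
  have := Summable.hasProdUniformlyOn_nat_one_add hK (hs.mul_left (4 / δ))
    (.of_forall hb) hcts
  have he : ∀ n, ∀ z ∈ K, 1 + -((1 + r n) * (1 - z) / (1 - r n * z)) =
      (z - (r n : ℂ)) / (1 - (r n : ℂ) * z) := by
    intro n z hz
    have := one_sub_mul_ne_zero (hr n) (hK1 z hz)
    field_simp
    ring
  refine (this.congr ?_).congr_right ?_
  · exact .of_forall fun s z hz => Finset.prod_congr rfl fun n _ => he n z hz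
  · intro z hz
    exact tprod_congr fun n => he n z hz

lemma norm_le_one_of_hasProd {φ : ℕ → ℂ} {P : ℂ} (h : HasProd φ P)
    (hz : ∀ n, ‖φ n‖ ≤ 1) : ‖P‖ ≤ 1 := by
  refine le_of_tendsto h.norm (.of_forall fun s => ?_)
  exact Finset.prod_le_one (fun _ _ => norm_nonneg _) fun n _ => hz n

lemma norm_eq_one_of_hasProd {φ : ℕ → ℂ} {P : ℂ} (h : HasProd φ P)
    (hz : ∀ n, ‖φ n‖ = 1) : ‖P‖ = 1 := by
  refine tendsto_nhds_unique (Tendsto.norm h) ?_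
  simp [norm_prod, hz]


lemma hasProd_blaschke {r : ℕ → ℝ} (hr : ∀ n, r n ∈ Ioo (-1 : ℝ) 0)
    (hs : Summable fun n => 1 + r n) {z : ℂ} (hz : ‖z‖ ≤ 1) (hz' : z ≠ -1) :
    HasProd (fun n => (z - (r n : ℂ)) / (1 - (r n : ℂ) * z)) (blaschkeProd r z) := by
  have h0 : 0 < ‖1 + z‖ := norm_pos_iff.2 fun h => hz' (by linear_combination h)
  exact (hasProdUniformlyOn_blaschke hr hs h0).hasProd ⟨by simpa using hz, le_refl ‖1 + z‖⟩

lemma ne_neg_one_of_mem {z : ℂ} (hz : z ∈ unitDisk) : z ≠ -1 := by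
  rintro rfl
  simp [mem_unitDisk] at hz

lemma norm_blaschkeProd_le {r : ℕ → ℝ} (hr : ∀ n, r n ∈ Ioo (-1 : ℝ) 0)
    (hs : Summable fun n => 1 + r n) {z : ℂ} (hz : z ∈ unitDisk) : ‖blaschkeProd r z‖ ≤ 1 := by
  have h1 := (mem_unitDisk.1 hz).le
  exact norm_le_one_of_hasProd (hasProd_blaschke hr hs h1 (ne_neg_one_of_mem hz))
    fun n => norm_blaschke_le (hr n) h1

lemma norm_blaschkeProd_eq {r : ℕ → ℝ} (hr : ∀ n, r n ∈ Ioo (-1 : ℝ) 0)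
    (hs : Summable fun n => 1 + r n) {z : ℂ} (hz : ‖z‖ = 1) (hz' : z ≠ -1) :
    ‖blaschkeProd r z‖ = 1 :=
  norm_eq_one_of_hasProd (hasProd_blaschke hr hs hz.le hz') fun n => norm_blaschke_eq (hr n) hz

lemma blaschkeProd_zero {r : ℕ → ℝ} (hr : ∀ n, r n ∈ Ioo (-1 : ℝ) 0)
    (hs : Summable fun n => 1 + r n) (n : ℕ) : blaschkeProd r (r n) = 0 := by
  have h1 : ((r n : ℝ) : ℂ) ∈ unitDisk := by
    rw [mem_unitDisk, Complex.norm_real, Real.norm_eq_abs, abs_lt]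
    exact ⟨(hr n).1, by linarith [(hr n).2]⟩
  exact (hasProd_blaschke hr hs (mem_unitDisk.1 h1).le (ne_neg_one_of_mem h1)).unique
    (hasProd_zero_of_exists_eq_zero ⟨n, by simp⟩)

lemma continuousOn_blaschkeProd {r : ℕ → ℝ} (hr : ∀ n, r n ∈ Ioo (-1 : ℝ) 0)
    (hs : Summable fun n => 1 + r n) {δ : ℝ} (hδ : 0 < δ) :
    ContinuousOn (blaschkeProd r) (Metric.closedBall 0 1 ∩ {z | δ ≤ ‖1 + z‖}) := by
  refine (hasProdUniformlyOn_blaschke hr hs hδ).tendstoUniformlyOn_finsetRange.continuousOn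
    (.of_forall fun N => continuousOn_finsetProd _ fun n _ => ?_)
  exact ContinuousOn.div (by fun_prop) (by fun_prop) fun z hz =>
    one_sub_mul_ne_zero (hr n) (by simpa using hz.1)

lemma differentiableOn_blaschkeProd {r : ℕ → ℝ} (hr : ∀ n, r n ∈ Ioo (-1 : ℝ) 0)
    (hs : Summable fun n => 1 + r n) : DifferentiableOn ℂ (blaschkeProd r) unitDisk := by
  have h : TendstoLocallyUniformlyOn
      (fun N z => ∏ n ∈ Finset.range N, (z - (r n : ℂ)) / (1 - (r n : ℂ) * z))
      (blaschkeProd r) atTop unitDisk := by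
    refine (tendstoLocallyUniformlyOn_iff_forall_isCompact Metric.isOpen_ball).2 fun K hK hKc => ?_
    rcases K.eq_empty_or_nonempty with rfl | hne
    · exact tendstoUniformlyOn_empty
    obtain ⟨z₀, hz₀, hmin⟩ := hKc.exists_isMinOn hne
      (f := fun z : ℂ => ‖1 + z‖) (by fun_prop)
    have h0 : 0 < ‖1 + z₀‖ := norm_pos_iff.2 fun h =>
      ne_neg_one_of_mem (hK hz₀) (by linear_combination h)
    refine (hasProdUniformlyOn_blaschke hr hs h0).tendstoUniformlyOn_finsetRange.mono
      fun z hz => ⟨?_, hmin hz⟩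
    simpa using (mem_unitDisk.1 (hK hz)).le
  refine h.differentiableOn (.of_forall fun N => ?_) Metric.isOpen_ball
  refine DifferentiableOn.fun_finsetProd fun n _ => ?_
  exact DifferentiableOn.div (by fun_prop) (by fun_prop) fun z hz =>
    one_sub_mul_ne_zero (hr n) (mem_unitDisk.1 hz).le

lemma tendsto_blaschkeProd {r : ℕ → ℝ} (hr : ∀ n, r n ∈ Ioo (-1 : ℝ) 0)
    (hs : Summable fun n => 1 + r n) {θ : ℝ} (hθ : uc θ ≠ -1) :
    Tendsto (fun t : ℝ => blaschkeProd r (t * uc θ)) (nhdsWithin 1 (Iio 1))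
      (nhds (blaschkeProd r (uc θ))) := by
  have h0 : 0 < ‖1 + uc θ‖ := norm_pos_iff.2 fun h => hθ (by linear_combination h)
  have hc := continuousOn_blaschkeProd hr hs (half_pos h0) (uc θ)
    ⟨by simp [norm_uc], by simp only [mem_ofPred_eq]; linarith⟩
  have ht : Tendsto (fun t : ℝ => (t : ℂ) * uc θ) (nhdsWithin 1 (Iio 1)) (nhds (uc θ)) := by
    have : Continuous fun t : ℝ => (t : ℂ) * uc θ := by fun_prop
    simpa using (this.tendsto 1).mono_left (nhdsWithin_le_nhds (s := Iio 1))
  refine hc.tendsto.comp (tendsto_nhdsWithin_iff.2 ⟨ht, ?_⟩)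
  have h1 : ∀ᶠ z in nhds (uc θ), ‖1 + uc θ‖ / 2 < ‖1 + z‖ := by
    have : Continuous fun z : ℂ => ‖1 + z‖ := by fun_prop
    exact (this.tendsto (uc θ)).eventually (lt_mem_nhds (by linarith))
  filter_upwards [ht.eventually h1, eventually_mem_Ico] with t h2 h3
  refine ⟨?_, h2.le⟩
  simp only [Metric.mem_closedBall, dist_zero_right]
  rw [norm_ofReal_mul_uc h3.1]
  exact h3.2.le

lemma IsInner.memH2 {I : ℂ → ℂ} (h : IsInner I) : MemH2 I := MemH2.of_bounded h.1 h.2.1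

lemma isInner_mul_blaschkeProd {r : ℕ → ℝ} (hr : ∀ n, r n ∈ Ioo (-1 : ℝ) 0)
    (hs : Summable fun n => 1 + r n) : IsInner fun z => z * blaschkeProd r z := by
  refine ⟨differentiableOn_id.mul (differentiableOn_blaschkeProd hr hs), fun z hz => ?_, ?_⟩
  · rw [norm_mul]
    have h1 := norm_blaschkeProd_le hr hs hz
    have h2 := (mem_unitDisk.1 hz).le
    nlinarith [norm_nonneg z, norm_nonneg (blaschkeProd r z)]
  · filter_upwards [ae_bMeasure ae_uc_ne_neg_one] with θ hθ
    have ht : Tendsto (fun t : ℝ => (t : ℂ) * uc θ) (nhdsWithin 1 (Iio 1)) (nhds (uc θ)) := by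
      have : Continuous fun t : ℝ => (t : ℂ) * uc θ := by fun_prop
      simpa using (this.tendsto 1).mono_left (nhdsWithin_le_nhds (s := Iio 1))
    rw [bdry_eq_of_tendsto (ht.mul (tendsto_blaschkeProd hr hs hθ)), norm_mul, norm_uc,
      norm_blaschkeProd_eq hr hs (norm_uc θ) hθ, one_mul]

lemma IsInner.congr {I J : ℂ → ℂ} (h : IsInner J) (e : ∀ z ∈ unitDisk, I z = J z) : IsInner I := by
  refine ⟨h.1.congr e, fun z hz => by rw [e z hz]; exact h.2.1 z hz, ?_⟩
  rw [bdry_congr e]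
  exact h.2.2

/-- The function `b₀`. -/
def bz (z : ℂ) : ℂ := z * (1 - z) / 2

/-- The function `1 / (1 - I b₀)`. -/
def wz (I : ℂ → ℂ) (z : ℂ) : ℂ := (1 - I z * bz z)⁻¹

lemma norm_one_sub_le_two {z : ℂ} (hz : ‖z‖ ≤ 1) : ‖1 - z‖ ≤ 2 :=
  (norm_sub_le _ _).trans (by rw [norm_one]; linarith)

lemma norm_bz (z : ℂ) : ‖bz z‖ = ‖z‖ * ‖1 - z‖ / 2 := by
  simp [bz]

lemma parallelogram_one (z : ℂ) : ‖1 + z‖ ^ 2 + ‖1 - z‖ ^ 2 = 2 + 2 * ‖z‖ ^ 2 := by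
  simp only [← Complex.normSq_eq_norm_sq, Complex.normSq_apply, Complex.sub_re, Complex.sub_im,
    Complex.add_re, Complex.add_im, Complex.one_re, Complex.one_im]
  ring

lemma norm_bz_lt_one {z : ℂ} (hz : z ∈ unitDisk) : ‖bz z‖ < 1 := by
  have h := mem_unitDisk.1 hz
  rw [norm_bz]
  have := norm_one_sub_le_two h.le
  nlinarith [norm_nonneg z, norm_nonneg (1 - z)]

lemma sq_add_sq_bz_le {z : ℂ} (hz : ‖z‖ ≤ 1) : ‖(1 + z) / 2‖ ^ 2 + ‖bz z‖ ^ 2 ≤ 1 := by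
  have := parallelogram_one z
  rw [norm_bz, norm_div, Complex.norm_ofNat, div_pow, div_pow, mul_pow]
  have h1 : ‖z‖ ^ 2 ≤ 1 := by nlinarith [norm_nonneg z]
  nlinarith [mul_le_mul_of_nonneg_right h1 (sq_nonneg ‖1 - z‖)]

lemma sq_add_sq_bz_eq {z : ℂ} (hz : ‖z‖ = 1) : ‖(1 + z) / 2‖ ^ 2 + ‖bz z‖ ^ 2 = 1 := by
  have := parallelogram_one z
  rw [hz] at this
  rw [norm_bz, norm_div, Complex.norm_ofNat, div_pow, div_pow, mul_pow, hz]
  linarith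

lemma norm_bz_uc_lt_one {z : ℂ} (hz : ‖z‖ = 1) (hz' : z ≠ -1) : ‖bz z‖ < 1 := by
  have h := sq_add_sq_bz_eq hz
  have h0 : 0 < ‖(1 + z) / 2‖ := norm_pos_iff.2 fun h => hz' (by linear_combination 2 * h)
  nlinarith [norm_nonneg (bz z)]

lemma differentiable_bz : Differentiable ℂ bz := by unfold bz; fun_prop

section Inner

variable {I : ℂ → ℂ}

lemma norm_mul_bz_lt_one (hI : IsInner I) {z : ℂ} (hz : z ∈ unitDisk) : ‖I z * bz z‖ < 1 := by
  rw [norm_mul]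
  nlinarith [hI.2.1 z hz, norm_bz_lt_one hz, norm_nonneg (I z), norm_nonneg (bz z)]

lemma one_sub_ne_zero_of_norm_lt {u : ℂ} (h : ‖u‖ < 1) : 1 - u ≠ 0 := by
  intro h0
  have : u = 1 := by linear_combination -h0
  simp [this] at h

lemma differentiableOn_wz (hI : IsInner I) : DifferentiableOn ℂ (wz I) unitDisk := by
  refine DifferentiableOn.inv ?_ fun z hz => one_sub_ne_zero_of_norm_lt (norm_mul_bz_lt_one hI hz)
  exact (hI.1.mul differentiable_bz.differentiableOn).const_sub 1

lemma tendsto_mul_uc (θ : ℝ) :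
    Tendsto (fun t : ℝ => (t : ℂ) * uc θ) (nhdsWithin 1 (Iio 1)) (nhds (uc θ)) := by
  have : Continuous fun t : ℝ => (t : ℂ) * uc θ := by fun_prop
  simpa using (this.tendsto 1).mono_left (nhdsWithin_le_nhds (s := Iio 1))

/-- A.e. boundary behaviour of `I` and of `1 / (1 - I b₀)`. -/
lemma IsInner.ae_boundary (hI : IsInner I) : ∀ᵐ θ ∂bMeasure,
    uc θ ≠ -1 ∧ ‖bdry I θ‖ = 1 ∧ 1 - bdry I θ * bz (uc θ) ≠ 0 ∧
    Tendsto (fun t : ℝ => I (t * uc θ)) (nhdsWithin 1 (Iio 1)) (nhds (bdry I θ)) ∧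
    Tendsto (fun t : ℝ => wz I (t * uc θ)) (nhdsWithin 1 (Iio 1))
      (nhds (1 - bdry I θ * bz (uc θ))⁻¹) := by
  filter_upwards [ae_bMeasure ae_uc_ne_neg_one, hI.2.2, hI.memH2.ae_tendsto_bdry] with θ h1 h2 h3
  have h4 : 1 - bdry I θ * bz (uc θ) ≠ 0 := one_sub_ne_zero_of_norm_lt (by
    rw [norm_mul, h2, one_mul]
    exact norm_bz_uc_lt_one (norm_uc θ) h1)
  refine ⟨h1, h2, h4, h3, Tendsto.inv₀ (tendsto_const_nhds.sub (h3.mul ?_)) h4⟩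
  exact (differentiable_bz.continuous.tendsto _).comp (tendsto_mul_uc θ)

lemma norm_wz_sq_le (hI : IsInner I) {z : ℂ} (hz : z ∈ unitDisk) :
    ‖(1 + z) / 2 * wz I z‖ ^ 2 ≤ 2 * (wz I z).re - 1 := by
  set u := I z * bz z with hu
  have hu1 : ‖u‖ < 1 := norm_mul_bz_lt_one hI hz
  have h0 : 0 < ‖1 - u‖ ^ 2 := by
    have := norm_pos_iff.2 (one_sub_ne_zero_of_norm_lt hu1)
    positivity
  have hub : ‖u‖ ≤ ‖bz z‖ := by
    rw [hu, norm_mul]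
    nlinarith [hI.2.1 z hz, norm_nonneg (bz z)]
  have hw : wz I z = (1 - u)⁻¹ := rfl
  have hre : 2 * (wz I z).re - 1 = (1 - ‖u‖ ^ 2) / ‖1 - u‖ ^ 2 := by
    rw [hw, Complex.inv_re, Complex.normSq_eq_norm_sq, eq_div_iff h0.ne', sub_mul, one_mul,
      ← mul_div_assoc, div_mul_cancel₀ _ h0.ne']
    simp only [← Complex.normSq_eq_norm_sq, Complex.normSq_apply, Complex.sub_re, Complex.sub_im,
      Complex.one_re, Complex.one_im]
    ring
  rw [hre, hw, norm_mul, norm_inv, mul_pow, inv_pow, ← div_eq_mul_inv]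
  gcongr
  have := sq_add_sq_bz_le (mem_unitDisk.1 hz).le
  nlinarith [norm_nonneg u]

lemma memH2_mul_wz (hI : IsInner I) (hI0 : I 0 = 0) : MemH2 fun z => (1 + z) / 2 * wz I z := by
  have hd := differentiableOn_wz hI
  have hd2 : DifferentiableOn ℂ (fun z => (1 + z) / 2 * wz I z) unitDisk :=
    DifferentiableOn.mul (by fun_prop) hd
  refine ⟨hd2, 2 * Real.pi, fun t ht => ?_⟩
  have hm : ∀ θ, (t : ℂ) * uc θ ∈ unitDisk := fun θ =>
    mem_unitDisk.2 (by rw [norm_ofReal_mul_uc ht.1]; exact ht.2)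
  have hc : Continuous fun θ : ℝ => wz I (t * uc θ) :=
    hd.continuousOn.comp_continuous (continuous_const.mul continuous_uc) hm
  have hc2 : Continuous fun θ : ℝ => (1 + t * uc θ) / 2 * wz I (t * uc θ) :=
    hd2.continuousOn.comp_continuous (continuous_const.mul continuous_uc) hm
  have hre : Continuous fun θ : ℝ => 2 * (wz I (t * uc θ)).re - 1 := by
    have := Complex.continuous_re.comp hc
    exact (continuous_const.mul this).sub continuous_const
  have hmean : ∫ θ in (0:ℝ)..(2 * Real.pi), wz I (t * uc θ) = 2 * Real.pi := by
    have h1 : DiffContOnCl ℂ (wz I) (Metric.ball 0 |t|) := by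
      refine DifferentiableOn.diffContOnCl (hd.mono ?_)
      refine (Metric.closure_ball_subset_closedBall).trans (Metric.closedBall_subset_ball ?_)
      rw [abs_of_nonneg ht.1]; exact ht.2
    have h2 := h1.circleAverage
    have h3 : wz I 0 = 1 := by simp [wz, hI0]
    rw [Real.circleAverage_def, h3] at h2
    have h4 : ∀ θ, circleMap 0 t θ = t * uc θ := fun θ => by simp [circleMap, uc]
    simp only [h4, Complex.real_smul] at h2
    have hpi : (Real.pi : ℂ) ≠ 0 := by exact_mod_cast Real.pi_ne_zero
    push_cast at h2
    field_simp at h2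
    exact h2
  have hmre : ∫ θ in (0:ℝ)..(2 * Real.pi), (2 * (wz I (t * uc θ)).re - 1) = 2 * Real.pi := by
    rw [intervalIntegral.integral_sub, intervalIntegral.integral_const_mul]
    · have : ∫ θ in (0:ℝ)..(2 * Real.pi), (wz I (t * uc θ)).re = 2 * Real.pi := by
        have := Complex.reCLM.intervalIntegral_comp_comm (μ := volume)
          (hc.intervalIntegrable 0 (2 * Real.pi))
        simp only [Complex.reCLM_apply] at this
        rw [this, hmean]
        simp
      rw [this]; simp; ring
    · exact (continuous_const.mul (Complex.continuous_re.comp hc)).intervalIntegrable _ _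
    · exact intervalIntegrable_const
  refine le_trans ?_ hmre.le
  refine intervalIntegral.integral_mono_on Real.two_pi_pos.le
    ((hc2.norm.pow 2).intervalIntegrable _ _) (hre.intervalIntegrable _ _) fun θ _ => ?_
  exact norm_wz_sq_le hI (hm θ)

lemma MemH2.add {f g : ℂ → ℂ} (hf : MemH2 f) (hg : MemH2 g) : MemH2 fun z => f z + g z := by
  obtain ⟨hfd, C, hC⟩ := hf
  obtain ⟨hgd, D, hD⟩ := hg
  refine ⟨hfd.add hgd, 2 * C + 2 * D, fun t ht => ?_⟩
  have hm : ∀ θ, (t : ℂ) * uc θ ∈ unitDisk := fun θ =>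
    mem_unitDisk.2 (by rw [norm_ofReal_mul_uc ht.1]; exact ht.2)
  have c1 : Continuous fun θ : ℝ => f (t * uc θ) :=
    hfd.continuousOn.comp_continuous (continuous_const.mul continuous_uc) hm
  have c2 : Continuous fun θ : ℝ => g (t * uc θ) :=
    hgd.continuousOn.comp_continuous (continuous_const.mul continuous_uc) hm
  have i1 : IntervalIntegrable (fun θ => 2 * ‖f (t * uc θ)‖ ^ 2) volume 0 (2 * Real.pi) :=
    ((c1.norm.pow 2).const_mul 2).intervalIntegrable _ _
  have i2 : IntervalIntegrable (fun θ => 2 * ‖g (t * uc θ)‖ ^ 2) volume 0 (2 * Real.pi) :=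
    ((c2.norm.pow 2).const_mul 2).intervalIntegrable _ _
  calc ∫ θ in (0:ℝ)..(2 * Real.pi), ‖f (t * uc θ) + g (t * uc θ)‖ ^ 2
      ≤ ∫ θ in (0:ℝ)..(2 * Real.pi), (2 * ‖f (t * uc θ)‖ ^ 2 + 2 * ‖g (t * uc θ)‖ ^ 2) := by
        refine intervalIntegral.integral_mono_on Real.two_pi_pos.le
          (((c1.add c2).norm.pow 2).intervalIntegrable _ _) (i1.add i2) fun θ _ => ?_
        have := norm_add_le (f (t * uc θ)) (g (t * uc θ))
        nlinarith [norm_nonneg (f (t * uc θ)), norm_nonneg (g (t * uc θ)),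
          sq_nonneg (‖f (t * uc θ)‖ - ‖g (t * uc θ)‖), norm_nonneg (f (t * uc θ) + g (t * uc θ))]
    _ = 2 * (∫ θ in (0:ℝ)..(2 * Real.pi), ‖f (t * uc θ)‖ ^ 2) +
        2 * ∫ θ in (0:ℝ)..(2 * Real.pi), ‖g (t * uc θ)‖ ^ 2 := by
        rw [intervalIntegral.integral_add i1 i2, intervalIntegral.integral_const_mul,
          intervalIntegral.integral_const_mul]
    _ ≤ _ := by linarith [hC t ht, hD t ht]

lemma MemH2.mul_bounded {f g : ℂ → ℂ} (hf : MemH2 f) (hgd : DifferentiableOn ℂ g unitDisk) {C : ℝ}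
    (hg : ∀ z ∈ unitDisk, ‖g z‖ ≤ C) : MemH2 fun z => g z * f z := by
  obtain ⟨hfd, D, hD⟩ := hf
  refine ⟨hgd.mul hfd, C ^ 2 * D, fun t ht => ?_⟩
  have hm : ∀ θ, (t : ℂ) * uc θ ∈ unitDisk := fun θ =>
    mem_unitDisk.2 (by rw [norm_ofReal_mul_uc ht.1]; exact ht.2)
  have c1 : Continuous fun θ : ℝ => f (t * uc θ) :=
    hfd.continuousOn.comp_continuous (continuous_const.mul continuous_uc) hm
  have c2 : Continuous fun θ : ℝ => g (t * uc θ) :=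
    hgd.continuousOn.comp_continuous (continuous_const.mul continuous_uc) hm
  calc ∫ θ in (0:ℝ)..(2 * Real.pi), ‖g (t * uc θ) * f (t * uc θ)‖ ^ 2
      ≤ ∫ θ in (0:ℝ)..(2 * Real.pi), C ^ 2 * ‖f (t * uc θ)‖ ^ 2 := by
        refine intervalIntegral.integral_mono_on Real.two_pi_pos.le
          (((c2.mul c1).norm.pow 2).intervalIntegrable _ _)
          (((c1.norm.pow 2).const_mul _).intervalIntegrable _ _) fun θ _ => ?_
        rw [norm_mul, mul_pow]
        gcongr
        exact hg _ (hm θ)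
    _ ≤ _ := by
        rw [intervalIntegral.integral_const_mul]
        exact mul_le_mul_of_nonneg_left (hD t ht) (sq_nonneg _)

lemma MemH2.const_mul {f : ℂ → ℂ} (hf : MemH2 f) (c : ℂ) : MemH2 fun z => c * f z :=
  hf.mul_bounded (g := fun _ => c) (by fun_prop) (C := ‖c‖) fun _ _ => le_rfl

/-- The function `g`. -/
def gz (I : ℂ → ℂ) (z : ℂ) : ℂ := (1 + I z) / 2 * wz I z

lemma memH2_gz (hI : IsInner I) (hI0 : I 0 = 0) : MemH2 (gz I) := by
  have h1 : MemH2 fun _ => (1 / 2 : ℂ) :=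
    MemH2.of_bounded (C := ‖(1 / 2 : ℂ)‖) (by fun_prop) (fun _ _ => le_rfl)
  have h2 : MemH2 fun z => (I z * (2 - z) / 2) * ((1 + z) / 2 * wz I z) := by
    refine (memH2_mul_wz hI hI0).mul_bounded (C := 3 / 2) ?_ fun z hz => ?_
    · exact (hI.1.mul (by fun_prop)).div_const 2
    · rw [norm_div, norm_mul, Complex.norm_ofNat]
      have h3 : ‖2 - z‖ ≤ 3 := (norm_sub_le _ _).trans (by
        rw [Complex.norm_ofNat]; linarith [mem_unitDisk.1 hz])
      have := hI.2.1 z hz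
      have : ‖I z‖ * ‖2 - z‖ ≤ 1 * 3 := by gcongr
      linarith
  refine (h1.add h2).congr fun z hz => ?_
  have h0 := one_sub_ne_zero_of_norm_lt (norm_mul_bz_lt_one hI hz)
  rw [gz, wz]
  field_simp
  rw [bz]
  ring

end Inner

/-! ### Pairing against the Cauchy kernel -/

lemma szProj_eq_bMeasure (F : ℝ → ℂ) (z : ℂ) :
    szProj F z = (1 / (2 * (Real.pi : ℂ))) * ∫ θ, F θ * (1 - z * (uc θ)⁻¹)⁻¹ ∂bMeasure := by
  rw [szProj, integral_bMeasure]

lemma one_sub_mul_inv_uc_ne_zero {z : ℂ} (hz : ‖z‖ < 1) (θ : ℝ) : 1 - z * (uc θ)⁻¹ ≠ 0 :=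
  one_sub_ne_zero_of_norm_lt (by rwa [norm_mul_inv_uc])

lemma continuous_cauchyKernel {z : ℂ} (hz : ‖z‖ < 1) :
    Continuous fun θ : ℝ => (1 - z * (uc θ)⁻¹)⁻¹ :=
  (continuous_const.sub (continuous_const.mul (continuous_uc.inv₀ uc_ne_zero))).inv₀
    (one_sub_mul_inv_uc_ne_zero hz)

lemma norm_cauchyKernel_le {z : ℂ} (hz : ‖z‖ < 1) (θ : ℝ) :
    ‖(1 - z * (uc θ)⁻¹)⁻¹‖ ≤ (1 - ‖z‖)⁻¹ := by
  rw [norm_inv]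
  refine inv_anti₀ (by linarith) ?_
  have := norm_sub_norm_le (1 : ℂ) (z * (uc θ)⁻¹)
  rwa [norm_one, norm_mul_inv_uc] at this

lemma memLp_mul_bounded {F G : ℝ → ℂ} (hF : MemLp F 2 bMeasure)
    (hG : AEStronglyMeasurable G bMeasure) {C : ℝ} (hC : ∀ᵐ θ ∂bMeasure, ‖G θ‖ ≤ C) :
    MemLp (fun θ => F θ * G θ) 2 bMeasure := by
  refine hF.of_le_mul (c := C) (hF.1.mul hG) ?_
  filter_upwards [hC] with θ hθ
  rw [norm_mul, mul_comm]
  gcongr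

lemma szProj_mul_uc_pow {F : ℝ → ℂ} (hF : HardyBdry F) {z : ℂ} (hz : ‖z‖ < 1) (k : ℕ) :
    szProj (fun θ => F θ * uc θ ^ k) z = szProj F z * z ^ k := by
  have h1 := hasSum_szProj (hF.mul_uc_pow k).integrable hz
  have h2 := (hasSum_szProj hF.integrable hz).mul_right (z ^ k)
  refine h1.unique ((hasSum_nat_add_iff' k).1 ?_)
  have h3 : ∀ n : ℕ, circCoeff (fun θ => F θ * uc θ ^ k) n = circCoeff F (n - k) := fun n => by
    simpa only [zpow_natCast] using circCoeff_mul_uc_zpow F k n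
  rw [Finset.sum_eq_zero, sub_zero]
  · refine h2.congr_fun ?_ 
    intro n
    rw [h3]
    push_cast
    rw [add_sub_cancel_right, pow_add, mul_assoc]
  · intro n hn
    rw [h3, hF.2 _ (by have := Finset.mem_range.1 hn; omega), zero_mul]

lemma integral_mul_cauchyKernel {N Y : ℝ → ℂ} (hN : HardyBdry N) (hY : HardyBdry Y) {z : ℂ}
    (hz : ‖z‖ < 1) :
    ∫ θ, N θ * (Y θ * (1 - z * (uc θ)⁻¹)⁻¹) ∂bMeasure =
      szProj N z * ∫ θ, Y θ * (1 - z * (uc θ)⁻¹)⁻¹ ∂bMeasure := by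
  set S : ℝ → ℂ := fun θ => (1 - z * (uc θ)⁻¹)⁻¹ with hS
  have hSm : AEStronglyMeasurable S bMeasure := (continuous_cauchyKernel hz).aestronglyMeasurable
  have hSb : ∀ᵐ θ ∂bMeasure, ‖S θ‖ ≤ (1 - ‖z‖)⁻¹ := .of_forall (norm_cauchyKernel_le hz)
  set c := szProj N z with hc
  have hF : MemLp (fun θ => (N θ - c) * S θ) 2 bMeasure :=
    memLp_mul_bounded (hN.sub (hardyBdry_const c)).1 hSm hSb
  have hYS : MemLp (fun θ => Y θ * S θ) 2 bMeasure := memLp_mul_bounded hY.1 hSm hSb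
  have hNS : MemLp (fun θ => N θ * S θ) 2 bMeasure := memLp_mul_bounded hN.1 hSm hSb
  have hcoef : ∀ k : ℕ, circCoeff (fun θ => (N θ - c) * S θ) (-k) = 0 := by
    intro k
    have h1 := szProj_mul_uc_pow (hN.sub (hardyBdry_const c)) hz k
    have h2 : szProj (fun θ => N θ - c) z = 0 := by
      have e1 := hasSum_szProj (hN.sub (hardyBdry_const c)).integrable hz
      have e2 := (hasSum_szProj hN.integrable hz).sub
        (hasSum_szProj (hardyBdry_const c).integrable hz)
      rw [szProj_const c hz, ← hc, sub_self] at e2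
      refine e1.unique (e2.congr_fun fun n => ?_)
      rw [circCoeff_sub hN.integrable (hardyBdry_const c).integrable, sub_mul]
    rw [h2, zero_mul, szProj_eq_bMeasure] at h1
    rw [circCoeff, ← h1]
    congr 2
    funext θ
    rw [neg_neg, zpow_natCast]
    ring
  have h0 := integral_mul_eq_zero hF hY.1 fun n => by
    rcases le_or_gt n 0 with hn | hn
    · left
      obtain ⟨k, rfl⟩ : ∃ k : ℕ, n = -k := ⟨(-n).toNat, by omega⟩
      exact hcoef k
    · exact .inr (hY.2 _ (by omega))
  have i1 : Integrable (fun θ => N θ * (Y θ * S θ)) bMeasure := MemLp.integrable_mul hN.1 hYS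
  have i2 : Integrable (fun θ => c * (Y θ * S θ)) bMeasure :=
    (hYS.integrable (by norm_num)).const_mul c
  rw [← integral_const_mul, ← sub_eq_zero, ← integral_sub i1 i2, ← h0]
  congr 1
  funext θ
  ring

/-! ### Boundary identities -/

/-- Boundary values of `1 - I b₀`. -/
def dB (I : ℂ → ℂ) (θ : ℝ) : ℂ := 1 - bdry I θ * bz (uc θ)

section

variable {I : ℂ → ℂ}

lemma bdry_wz (hI : IsInner I) : ∀ᵐ θ ∂bMeasure, bdry (wz I) θ = (dB I θ)⁻¹ := by
  filter_upwards [hI.ae_boundary] with θ h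
  exact bdry_eq_of_tendsto h.2.2.2.2

lemma bdry_fz (hI : IsInner I) :
    ∀ᵐ θ ∂bMeasure, bdry (fun z => (1 + z) / 2 * wz I z) θ = (1 + uc θ) / 2 * (dB I θ)⁻¹ := by
  filter_upwards [hI.ae_boundary] with θ h
  exact bdry_eq_of_tendsto (((tendsto_mul_uc θ).const_add 1).div_const 2 |>.mul h.2.2.2.2)

lemma bdry_gz (hI : IsInner I) :
    ∀ᵐ θ ∂bMeasure, bdry (gz I) θ = (1 + bdry I θ) / 2 * (dB I θ)⁻¹ := by
  filter_upwards [hI.ae_boundary] with θ h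
  exact bdry_eq_of_tendsto ((h.2.2.2.1.const_add 1).div_const 2 |>.mul h.2.2.2.2)

lemma bdry_mul_of_continuous {p s : ℂ → ℂ} (hp : MemH2 p) (hs : ∀ᵐ θ : ℝ, ContinuousAt s (uc θ)) :
    ∀ᵐ θ ∂bMeasure, bdry (fun z => s z * p z) θ = s (uc θ) * bdry p θ := by
  filter_upwards [hp.ae_tendsto_bdry, ae_bMeasure hs] with θ h1 h2
  exact bdry_eq_of_tendsto ((h2.tendsto.comp (tendsto_mul_uc θ)).mul h1)

lemma MemH2.bdry_mul {p q : ℂ → ℂ} (hp : MemH2 p) (hq : MemH2 q) :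
    ∀ᵐ θ ∂bMeasure, bdry (fun z => p z * q z) θ = bdry p θ * bdry q θ := by
  filter_upwards [hp.ae_tendsto_bdry, hq.ae_tendsto_bdry] with θ h1 h2
  exact bdry_eq_of_tendsto (h1.mul h2)

lemma symbIf_spec (hI : IsInner I) : ∀ᵐ θ ∂bMeasure,
    uc θ * symbIf I (fun z => (1 + z) / 2 * wz I z) θ * (starRingEnd ℂ) (dB I θ) =
      (starRingEnd ℂ) (bdry I θ) * dB I θ := by
  filter_upwards [hI.ae_boundary, bdry_fz hI] with θ h h2
  have hu := uc_ne_zero θ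
  have hd : dB I θ ≠ 0 := h.2.2.1
  have hd' : (starRingEnd ℂ) (dB I θ) ≠ 0 := by simpa using hd
  have h1 : 1 + uc θ ≠ 0 := fun e => h.1 (by linear_combination e)
  have h1' : 1 + (uc θ)⁻¹ ≠ 0 := by
    intro e; apply h1; field_simp at e; linear_combination e
  rw [symbIf, h2]
  simp only [map_mul, map_div₀, map_add, map_one, map_inv₀, conj_uc, map_ofNat]
  field_simp
  ring

/-- The pointwise identity behind all pairings with `f K_I`. -/
lemma mul_conj_fz_mul (hI : IsInner I) : ∀ᵐ θ ∂bMeasure, ∀ H K : ℂ,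
    (starRingEnd ℂ) K * (starRingEnd ℂ) (dB I θ) = (starRingEnd ℂ) (bdry I θ) * dB I θ * H →
    H * (starRingEnd ℂ) (bdry (fun z => (1 + z) / 2 * wz I z) θ) * (1 + (uc θ)⁻¹) =
      2 * (H * (starRingEnd ℂ) (uc θ)) + 2 * (starRingEnd ℂ) (uc θ * bz (uc θ) * K) := by
  filter_upwards [hI.ae_boundary, bdry_fz hI] with θ h h2 H K hK
  have hu := uc_ne_zero θ
  have hd : dB I θ ≠ 0 := h.2.2.1
  have hd' : (starRingEnd ℂ) (dB I θ) ≠ 0 := by simpa using hd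
  have hι : bdry I θ * (starRingEnd ℂ) (bdry I θ) = 1 := by
    rw [Complex.mul_conj, Complex.normSq_eq_norm_sq, h.2.1]; simp
  have hK' : (starRingEnd ℂ) K =
      (starRingEnd ℂ) (bdry I θ) * dB I θ * H / (starRingEnd ℂ) (dB I θ) := by
    rw [eq_div_iff hd', hK]
  rw [h2]
  simp only [map_mul, hK']
  simp only [map_div₀, map_add, map_one, map_inv₀, conj_uc, map_ofNat]
  have e1 : (starRingEnd ℂ) (dB I θ) =
      1 - (starRingEnd ℂ) (bdry I θ) * (starRingEnd ℂ) (bz (uc θ)) := by simp [dB]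
  have e2 : (starRingEnd ℂ) (bz (uc θ)) = (uc θ)⁻¹ * (1 - (uc θ)⁻¹) / 2 := by
    simp only [bz, map_div₀, map_mul, map_sub, map_one, conj_uc, map_ofNat]
  have e3 : (1 + (uc θ)⁻¹) ^ 2 / 4 = (uc θ)⁻¹ * (1 - bz (uc θ) * (starRingEnd ℂ) (bz (uc θ))) := by
    rw [e2, bz]
    field_simp
    ring
  have key : H * (1 + (uc θ)⁻¹) ^ 2 / 2 = 2 * H * (uc θ)⁻¹ * ((starRingEnd ℂ) (dB I θ) +
      (starRingEnd ℂ) (bz (uc θ)) * (starRingEnd ℂ) (bdry I θ) * dB I θ) := by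
    rw [e1, dB]
    linear_combination 2 * H * e3 +
      2 * H * (uc θ)⁻¹ * bz (uc θ) * (starRingEnd ℂ) (bz (uc θ)) * hι
  generalize (starRingEnd ℂ) (dB I θ) = D' at *
  generalize (uc θ)⁻¹ = v at *
  field_simp
  linear_combination 2 * key

end

section

variable {I : ℂ → ℂ}

lemma gz_symm (hI : IsInner I) : ∀ᵐ θ ∂bMeasure,
    (starRingEnd ℂ) (bdry (gz I) θ) * (starRingEnd ℂ) (dB I θ) =
      (starRingEnd ℂ) (bdry I θ) * dB I θ * bdry (gz I) θ := by
  filter_upwards [hI.ae_boundary, bdry_gz hI] with θ h h2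
  have hd : dB I θ ≠ 0 := h.2.2.1
  have hd' : (starRingEnd ℂ) (dB I θ) ≠ 0 := by simpa using hd
  have hι : bdry I θ * (starRingEnd ℂ) (bdry I θ) = 1 := by
    rw [Complex.mul_conj, Complex.normSq_eq_norm_sq, h.2.1]; simp
  rw [h2]
  simp only [map_mul, map_div₀, map_add, map_one, map_inv₀, map_ofNat]
  field_simp
  linear_combination -hι

lemma szProj_congr {F G : ℝ → ℂ} (h : F =ᵐ[bMeasure] G) (z : ℂ) : szProj F z = szProj G z := by
  rw [szProj_eq_bMeasure, szProj_eq_bMeasure]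
  congr 1
  exact integral_congr_ae (by filter_upwards [h] with θ hθ; rw [hθ])

lemma circCoeff_conj_mul_uc {K : ℝ → ℂ} (hK : HardyBdry K) (n : ℕ) :
    circCoeff (fun θ => (starRingEnd ℂ) (uc θ * K θ)) n = 0 := by
  rw [circCoeff_conj, circCoeff_congr (G := fun θ => K θ * uc θ ^ (1 : ℤ))
    (.of_forall fun θ => by simp [mul_comm]), circCoeff_mul_uc_zpow, hK.2 _ (by omega), map_zero]

lemma integrable_conj_mul_uc {K : ℝ → ℂ} (hK : HardyBdry K) :
    Integrable (fun θ => (starRingEnd ℂ) (uc θ * K θ)) bMeasure := by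
  have := memLp_conj (hK.mul_uc_pow 1).1
  refine (this.integrable (by norm_num)).congr (.of_forall fun θ => ?_)
  simp [mul_comm]

/-- A function `H` in `H²` with `H \bar I (1 - b) = \bar K (1 - \bar b)`, `K` in `H²`,
lies in the Toeplitz kernel. -/
lemma mem_toeplitzKer_of_symm (hI : IsInner I) {h : ℂ → ℂ} (hh : MemH2 h) {K : ℝ → ℂ}
    (hK : HardyBdry K) (hs : ∀ᵐ θ ∂bMeasure, (starRingEnd ℂ) (K θ) * (starRingEnd ℂ) (dB I θ) =
      (starRingEnd ℂ) (bdry I θ) * dB I θ * bdry h θ) :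
    h ∈ toeplitzKer (symbIf I fun z => (1 + z) / 2 * wz I z) := by
  refine ⟨hh, fun z hz => ?_⟩
  rw [toeplitz, szProj_congr (G := fun θ => (starRingEnd ℂ) (uc θ * K θ))]
  · exact szProj_eq_zero (integrable_conj_mul_uc hK) (circCoeff_conj_mul_uc hK) z hz
  · filter_upwards [hI.ae_boundary, hs, symbIf_spec hI] with θ h1 h2 h3
    have hd : dB I θ ≠ 0 := h1.2.2.1
    have hd' : (starRingEnd ℂ) (dB I θ) ≠ 0 := by simpa using hd
    refine mul_left_cancel₀ (mul_ne_zero (uc_ne_zero θ) hd') ?_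
    rw [map_mul, conj_uc]
    have e := mul_inv_cancel₀ (uc_ne_zero θ)
    linear_combination (bdry h θ) * h3 - h2 -
      (starRingEnd ℂ) (K θ) * (starRingEnd ℂ) (dB I θ) * e

/-- The coefficients of `\bar I P` for `P` in the model space. -/
lemma modelSpace_coeff (hI : IsInner I) {p : ℂ → ℂ} (hp : p ∈ modelSpace I) :
    HardyBdry fun θ => (starRingEnd ℂ) (uc θ * ((starRingEnd ℂ) (bdry I θ) * bdry p θ)) := by
  have hm : MemLp (fun θ => (starRingEnd ℂ) (bdry I θ) * bdry p θ) 2 bMeasure := by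
    have := memLp_mul_bounded (F := bdry p) (G := fun θ => (starRingEnd ℂ) (bdry I θ)) (C := 1)
      hp.1.hardyBdry.1
      (memLp_conj hI.memH2.hardyBdry.1).1 (by
        filter_upwards [hI.2.2] with θ hθ
        rw [RCLike.norm_conj, hθ])
    simpa only [mul_comm] using this
  have hc := circCoeff_eq_zero_of_szProj (hm.integrable (by norm_num)) hp.2
  have hm2 : MemLp (fun θ => uc θ * ((starRingEnd ℂ) (bdry I θ) * bdry p θ)) 2 bMeasure := by
    simpa [mul_comm] using memLp_mul_uc_zpow hm 1
  refine ⟨memLp_conj hm2, fun n hn => ?_⟩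
  rw [circCoeff_conj, circCoeff_congr
    (G := fun θ => ((starRingEnd ℂ) (bdry I θ) * bdry p θ) * uc θ ^ (1 : ℤ))
    (.of_forall fun θ => by simp [mul_comm]), circCoeff_mul_uc_zpow]
  obtain ⟨k, hk⟩ : ∃ k : ℕ, -n - 1 = k := ⟨(-n - 1).toNat, by omega⟩
  rw [hk, hc, map_zero]

/-- The damping factor `1 / (1 - r z)`. -/
def kz (r : ℝ) (z : ℂ) : ℂ := (1 - r * z)⁻¹

lemma differentiableAt_kz {r : ℝ} (hr : r ∈ Ioo (-1 : ℝ) 0) {z : ℂ} (hz : ‖z‖ ≤ 1) :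
    DifferentiableAt ℂ (kz r) z :=
  DifferentiableAt.inv (by fun_prop) (one_sub_mul_ne_zero hr hz)

lemma one_add_le_norm {r : ℝ} (hr : r ∈ Ioo (-1 : ℝ) 0) {z : ℂ} (hz : ‖z‖ ≤ 1) :
    1 + r ≤ ‖1 - r * z‖ := by
  have h3 : ‖(r : ℂ) * z‖ ≤ -r := by
    rw [norm_mul, Complex.norm_real, Real.norm_of_nonpos hr.2.le]
    nlinarith [hr.2]
  have := norm_sub_norm_le (1 : ℂ) (r * z)
  rw [norm_one] at this
  linarith

lemma norm_kz_le {r : ℝ} (hr : r ∈ Ioo (-1 : ℝ) 0) {z : ℂ} (hz : ‖z‖ ≤ 1) :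
    ‖kz r z‖ ≤ (1 + r)⁻¹ := by
  rw [kz, norm_inv]
  exact inv_anti₀ (by linarith [hr.1]) (one_add_le_norm hr hz)

lemma conj_kz (r : ℝ) (θ : ℝ) : (starRingEnd ℂ) (kz r (uc θ)) = (1 - r * (uc θ)⁻¹)⁻¹ := by
  simp [kz, conj_uc]

/-- Exact value of the damped pairing of `g` with `f p`. -/
lemma integral_gz_damped (hI : IsInner I) (hI0 : I 0 = 0) {p : ℂ → ℂ} (hp : p ∈ modelSpace I)
    {r : ℝ} (hr : r ∈ Ioo (-1 : ℝ) 0) (hIr : I r = 0) :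
    ∫ θ, bdry (gz I) θ * (starRingEnd ℂ) (bdry (fun z => (1 + z) / 2 * wz I z) θ * bdry p θ) *
      ((1 + (uc θ)⁻¹) * (1 - r * (uc θ)⁻¹)⁻¹) ∂bMeasure =
    (2 - r) / 2 * ((1 + r) * ∫ θ, (starRingEnd ℂ)
      (uc θ * ((starRingEnd ℂ) (bdry I θ) * bdry p θ)) * (1 - r * (uc θ)⁻¹)⁻¹ ∂bMeasure) := by
  have hg := memH2_gz hI hI0
  have hY := modelSpace_coeff hI hp
  set Y := fun θ => (starRingEnd ℂ) (uc θ * ((starRingEnd ℂ) (bdry I θ) * bdry p θ)) with hYd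
  have hr1 : ‖(r : ℂ)‖ < 1 := by
    rw [Complex.norm_real, Real.norm_eq_abs, abs_lt]; exact ⟨hr.1, by linarith [hr.2]⟩
  have hkd : DifferentiableOn ℂ (kz r) unitDisk := fun z hz =>
    (differentiableAt_kz hr (mem_unitDisk.1 hz).le).differentiableWithinAt
  have hkp : MemH2 fun z => kz r z * p z :=
    hp.1.mul_bounded hkd fun z hz => norm_kz_le hr (mem_unitDisk.1 hz).le
  have hbkp : MemH2 fun z => bz z * (kz r z * p z) :=
    hkp.mul_bounded differentiable_bz.differentiableOn fun z hz => (norm_bz_lt_one hz).le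
  have hbg : MemH2 fun z => bz z * gz I z :=
    hg.mul_bounded differentiable_bz.differentiableOn fun z hz => (norm_bz_lt_one hz).le
  have hn : MemH2 fun z => 1 + 2 * (bz z * gz I z) :=
    (MemH2.of_bounded (h := fun _ => 1) (C := 1) (by fun_prop) (by simp)).add (hbg.const_mul 2)
  set n := fun z => 1 + 2 * (bz z * gz I z) with hnd
  have hnr : szProj (bdry n) r = (2 - r) * (1 + r) / 2 := by
    rw [← hn.eq_szProj hr1]
    simp only [hnd, gz, wz, hIr, bz]
    simp
    ring
  have b1 : ∀ᵐ θ ∂bMeasure, bdry n θ = 1 + 2 * (bz (uc θ) * bdry (gz I) θ) := by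
    filter_upwards [hg.ae_tendsto_bdry] with θ h1
    exact bdry_eq_of_tendsto (((((differentiable_bz.continuous.tendsto _).comp
      (tendsto_mul_uc θ)).mul h1).const_mul 2).const_add 1)
  have b2 := bdry_mul_of_continuous (s := kz r) hp.1
    (.of_forall fun θ => (differentiableAt_kz hr (norm_uc θ).le).continuousAt)
  have b3 := bdry_mul_of_continuous (s := bz) hkp
    (.of_forall fun θ => differentiable_bz.continuous.continuousAt)
  have z1 := hg.hardyBdry.integral_mul_uc hbkp.hardyBdry 0
  have z2 := (hardyBdry_const 1).integral_mul_uc hkp.hardyBdry 0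
  have z3 := integral_mul_cauchyKernel hn.hardyBdry hY hr1
  rw [hnr] at z3
  have z1' : ∫ θ, (starRingEnd ℂ) (bdry (gz I) θ * (bdry (fun z => bz z * (kz r z * p z)) θ *
      uc θ ^ (0 + 1))) ∂bMeasure = 0 := by rw [integral_conj, z1, map_zero]
  have z2' : ∫ θ, (starRingEnd ℂ) (1 * (bdry (fun z => kz r z * p z) θ *
      uc θ ^ (0 + 1))) ∂bMeasure = 0 := by rw [integral_conj, z2, map_zero]
  have hfin : ∫ θ, bdry n θ * (Y θ * (1 - r * (uc θ)⁻¹)⁻¹) ∂bMeasure =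
      (2 - r) / 2 * ((1 + r) * ∫ θ, Y θ * (1 - r * (uc θ)⁻¹)⁻¹ ∂bMeasure) := by
    rw [z3]; ring
  have i1 : Integrable (fun θ => (starRingEnd ℂ) (bdry (gz I) θ *
      (bdry (fun z => bz z * (kz r z * p z)) θ * uc θ ^ (0 + 1)))) bMeasure := by
    have := MemLp.integrable_mul (memLp_conj hg.hardyBdry.1)
      (memLp_conj (hbkp.hardyBdry.mul_uc_pow 1).1)
    refine this.congr (.of_forall fun θ => ?_)
    simp
  have i2 : Integrable (fun θ => (starRingEnd ℂ) (1 * (bdry (fun z => kz r z * p z) θ *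
      uc θ ^ (0 + 1)))) bMeasure := by
    have := (memLp_conj (hkp.hardyBdry.mul_uc_pow 1).1).integrable (by norm_num)
    refine this.congr (.of_forall fun θ => ?_)
    simp
  have i3 : Integrable (fun θ => bdry n θ * (Y θ * (1 - r * (uc θ)⁻¹)⁻¹)) bMeasure :=
    MemLp.integrable_mul hn.hardyBdry.1 (memLp_mul_bounded hY.1
      (continuous_cauchyKernel hr1).aestronglyMeasurable (.of_forall (norm_cauchyKernel_le hr1)))
  rw [← hfin]
  have hsum := integral_add (i1.const_mul 2) (i2.add i3)
  rw [integral_const_mul, z1', mul_zero, zero_add] at hsum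
  have hsum2 := integral_add i2 i3
  rw [z2', zero_add] at hsum2
  simp only [Pi.add_apply] at hsum
  rw [hsum2] at hsum
  simp only [zero_add] at hsum
  rw [← hsum]
  refine integral_congr_ae ?_
  filter_upwards [b1, b2, b3, gz_symm hI, mul_conj_fz_mul hI, hI.ae_boundary, bdry_gz hI]
    with θ h1 h2 h3 h4 h5 h6 h7
  have hι : bdry I θ * (starRingEnd ℂ) (bdry I θ) = 1 := by
    rw [Complex.mul_conj, Complex.normSq_eq_norm_sq, h6.2.1]; simp
  have hd : dB I θ ≠ 0 := h6.2.2.1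
  have e1 : 2 * bdry (gz I) θ = 1 + bdry I θ * bdry n θ := by
    have : bdry (gz I) θ * dB I θ = (1 + bdry I θ) / 2 := by rw [h7]; field_simp
    rw [h1]
    rw [dB] at this
    linear_combination 2 * this
  have e5 := h5 _ _ h4
  rw [h3, h2]
  simp only [hYd, map_mul, ← conj_kz, pow_one, Complex.conj_conj, one_mul] at e5 ⊢
  linear_combination (starRingEnd ℂ) (bdry p θ) * (starRingEnd ℂ) (kz r (uc θ)) * e5 +
    (starRingEnd ℂ) (bdry p θ) * (starRingEnd ℂ) (kz r (uc θ)) * (starRingEnd ℂ) (uc θ) * e1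

end

lemma norm_inv_uc (θ : ℝ) : ‖(uc θ)⁻¹‖ = 1 := by rw [norm_inv, norm_uc, inv_one]

lemma one_add_inv_uc_ne_zero {θ : ℝ} (h : uc θ ≠ -1) : 1 + (uc θ)⁻¹ ≠ 0 := by
  intro e
  have hu := uc_ne_zero θ
  field_simp at e
  exact h (by linear_combination e)

lemma tendsto_damping {r : ℕ → ℝ} (hrlim : Tendsto r atTop (nhds (-1))) {θ : ℝ} (h : uc θ ≠ -1) :
    Tendsto (fun m => (1 - (r m : ℂ) * (uc θ)⁻¹)⁻¹) atTop (nhds (1 + (uc θ)⁻¹)⁻¹) := by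
  have h1 : Tendsto (fun m => (r m : ℂ)) atTop (nhds ((-1 : ℝ) : ℂ)) :=
    (Complex.continuous_ofReal.tendsto _).comp hrlim
  have h2 := (h1.mul_const (uc θ)⁻¹).const_sub 1
  simp only [Complex.ofReal_neg, Complex.ofReal_one, neg_mul, one_mul, sub_neg_eq_add] at h2
  exact h2.inv₀ (one_add_inv_uc_ne_zero h)

lemma continuous_damping {r : ℝ} (hr : r ∈ Ioo (-1 : ℝ) 0) :
    Continuous fun θ : ℝ => (1 - (r : ℂ) * (uc θ)⁻¹)⁻¹ :=
  continuous_cauchyKernel (by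
    rw [Complex.norm_real, Real.norm_eq_abs, abs_lt]; exact ⟨hr.1, by linarith [hr.2]⟩)

lemma tendsto_integral_damped {r : ℕ → ℝ} (hr : ∀ n, r n ∈ Ioo (-1 : ℝ) 0)
    (hrlim : Tendsto r atTop (nhds (-1))) {X : ℝ → ℂ} (hX : Integrable X bMeasure) :
    Tendsto (fun m => ∫ θ, X θ * ((1 + (uc θ)⁻¹) * (1 - r m * (uc θ)⁻¹)⁻¹) ∂bMeasure) atTop
      (nhds (∫ θ, X θ ∂bMeasure)) := by
  refine tendsto_integral_of_dominated_convergence (fun θ => ‖X θ‖ * 2) (fun m => ?_)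
    (hX.norm.mul_const 2) (fun m => .of_forall fun θ => ?_) ?_
  · refine hX.1.mul (Continuous.aestronglyMeasurable ?_)
    exact (continuous_const.add (continuous_uc.inv₀ uc_ne_zero)).mul (continuous_damping (hr m))
  · rw [norm_mul, norm_mul, norm_inv]
    gcongr
    have h1 := norm_one_add_le_two_mul (hr m) (norm_inv_uc θ).le
    have h2 := norm_pos_iff.2 (one_sub_mul_ne_zero (hr m) (norm_inv_uc θ).le)
    rw [← div_eq_mul_inv, div_le_iff₀ h2]
    exact h1
  · filter_upwards [ae_bMeasure ae_uc_ne_neg_one] with θ hθ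
    have := ((tendsto_damping hrlim hθ).const_mul (1 + (uc θ)⁻¹)).const_mul (X θ)
    rwa [mul_inv_cancel₀ (one_add_inv_uc_ne_zero hθ), mul_one] at this

lemma tendsto_integral_damped_zero {r : ℕ → ℝ} (hr : ∀ n, r n ∈ Ioo (-1 : ℝ) 0)
    (hrlim : Tendsto r atTop (nhds (-1))) {Y : ℝ → ℂ} (hY : Integrable Y bMeasure) :
    Tendsto (fun m => (1 + (r m : ℂ)) * ∫ θ, Y θ * (1 - r m * (uc θ)⁻¹)⁻¹ ∂bMeasure) atTop
      (nhds 0) := by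
  have key : Tendsto (fun m => ∫ θ, Y θ * ((1 + r m) * (1 - r m * (uc θ)⁻¹)⁻¹) ∂bMeasure) atTop
      (nhds (∫ θ, (0 : ℂ) ∂bMeasure)) := by
    refine tendsto_integral_of_dominated_convergence (fun θ => ‖Y θ‖ * 1) (fun m => ?_)
      (hY.norm.mul_const 1) (fun m => .of_forall fun θ => ?_) ?_
    · exact hY.1.mul (continuous_const.mul (continuous_damping (hr m))).aestronglyMeasurable
    · rw [norm_mul, norm_mul, norm_inv]
      gcongr
      have h1 := one_add_le_norm (hr m) (norm_inv_uc θ).le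
      have h2 := norm_pos_iff.2 (one_sub_mul_ne_zero (hr m) (norm_inv_uc θ).le)
      have h3 : ‖(1 + (r m : ℂ))‖ = 1 + r m := by
        rw [← Complex.ofReal_one, ← Complex.ofReal_add,
          Complex.norm_of_nonneg (by linarith [(hr m).1])]
      rw [← div_eq_mul_inv, div_le_iff₀ h2, h3, one_mul]
      exact h1
    · filter_upwards [ae_bMeasure ae_uc_ne_neg_one] with θ hθ
      have h1 : Tendsto (fun m => 1 + (r m : ℂ)) atTop (nhds (1 + ((-1 : ℝ) : ℂ))) :=
        ((Complex.continuous_ofReal.tendsto _).comp hrlim).const_add 1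
      have := (h1.mul (tendsto_damping hrlim hθ)).const_mul (Y θ)
      simpa using this
  rw [integral_zero] at key
  refine key.congr fun m => ?_
  rw [← integral_const_mul]
  congr 1
  funext θ
  ring

lemma integral_gz_mul_conj {r : ℕ → ℝ} (hr : ∀ n, r n ∈ Ioo (-1 : ℝ) 0)
    (hrlim : Tendsto r atTop (nhds (-1))) {I : ℂ → ℂ} (hI : IsInner I) (hI0 : I 0 = 0)
    (hIr : ∀ n, I (r n) = 0) {p : ℂ → ℂ} (hp : p ∈ modelSpace I) :
    ∫ θ, bdry (gz I) θ * (starRingEnd ℂ) (bdry (fun z => (1 + z) / 2 * wz I z) θ * bdry p θ)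
      ∂bMeasure = 0 := by
  set X := fun θ => bdry (gz I) θ *
    (starRingEnd ℂ) (bdry (fun z => (1 + z) / 2 * wz I z) θ * bdry p θ) with hXd
  by_cases hX : Integrable X bMeasure
  · refine tendsto_nhds_unique (tendsto_integral_damped hr hrlim hX) ?_
    have h1 : Tendsto (fun m => (2 - (r m : ℂ)) / 2) atTop (nhds ((2 - ((-1 : ℝ) : ℂ)) / 2)) :=
      (((Complex.continuous_ofReal.tendsto _).comp hrlim).const_sub 2).div_const 2
    have h2 := h1.mul (tendsto_integral_damped_zero hr hrlim (modelSpace_coeff hI hp).integrable)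
    rw [mul_zero] at h2
    exact h2.congr fun m => (integral_gz_damped hI hI0 hp (hr m) (hIr m)).symm
  · exact integral_undef hX

/-- Multiples of `g` are orthogonal to `f K_I` in the Toeplitz kernel. -/
lemma const_mul_gz_mem_kerPerp {r : ℕ → ℝ} (hr : ∀ n, r n ∈ Ioo (-1 : ℝ) 0)
    (hrlim : Tendsto r atTop (nhds (-1))) {I : ℂ → ℂ} (hI : IsInner I) (hI0 : I 0 = 0)
    (hIr : ∀ n, I (r n) = 0) (c : ℂ) {h : ℂ → ℂ} (hh : ∀ z ∈ unitDisk, h z = c * gz I z) :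
    h ∈ kerPerp I fun z => (1 + z) / 2 * wz I z := by
  have hg := memH2_gz hI hI0
  have hb : ∀ᵐ θ ∂bMeasure, bdry h θ = c * bdry (gz I) θ := by
    rw [bdry_congr hh]
    filter_upwards [hg.ae_tendsto_bdry] with θ h1
    exact bdry_eq_of_tendsto (h1.const_mul c)
  refine ⟨?_, ?_⟩
  · refine mem_toeplitzKer_of_symm hI ((hg.const_mul c).congr hh)
      (hg.hardyBdry.const_mul ((starRingEnd ℂ) c)) ?_
    filter_upwards [hb, gz_symm hI] with θ h1 h2
    rw [h1, map_mul, Complex.conj_conj]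
    linear_combination c * h2
  · rintro k ⟨p, hp, hk⟩
    rw [bInner, ← integral_bMeasure]
    have hbk : ∀ᵐ θ ∂bMeasure, bdry k θ =
        bdry (fun z => (1 + z) / 2 * wz I z) θ * bdry p θ := by
      rw [bdry_congr hk]
      exact (memH2_mul_wz hI hI0).bdry_mul hp.1
    rw [integral_congr_ae (g := fun θ => c * (bdry (gz I) θ *
      (starRingEnd ℂ) (bdry (fun z => (1 + z) / 2 * wz I z) θ * bdry p θ))), integral_const_mul,
      integral_gz_mul_conj hr hrlim hI hI0 hIr hp, mul_zero, mul_zero]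
    filter_upwards [hb, hbk] with θ h1 h2
    rw [h1, h2, mul_assoc]

/-! ### Backward shifts of bounded functions -/

lemma exists_backward_shift {ψ : ℂ → ℂ} (hd : DifferentiableOn ℂ ψ unitDisk)
    (hb : ∃ C : ℝ, ∀ z ∈ unitDisk, ‖ψ z‖ ≤ C) :
    ∃ χ : ℂ → ℂ, DifferentiableOn ℂ χ unitDisk ∧ (∃ C : ℝ, ∀ z ∈ unitDisk, ‖χ z‖ ≤ C) ∧
      ∀ m : ℕ, circCoeff (bdry χ) m = circCoeff (bdry ψ) (m + 1) := by
  obtain ⟨C, hC⟩ := hb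
  have h0 : (0 : ℂ) ∈ unitDisk := by simp [mem_unitDisk]
  have hχd : DifferentiableOn ℂ (dslope ψ 0) unitDisk :=
    (Complex.differentiableOn_dslope (Metric.isOpen_ball.mem_nhds h0)).2 hd
  have hχb : ∀ z ∈ unitDisk, ‖dslope ψ 0 z‖ ≤ (2 * C + 1) / 1 := fun z hz => by
    refine Complex.norm_dslope_le_div_of_mapsTo_ball (R₂ := 2 * C + 1) hd (fun w hw => ?_) hz
    rw [Metric.mem_closedBall, dist_eq_norm]
    have := norm_sub_le (ψ w) (ψ 0)
    linarith [hC w hw, hC 0 h0]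
  have hχ : MemH2 (dslope ψ 0) := MemH2.of_bounded hχd hχb
  refine ⟨dslope ψ 0, hχd, ⟨_, hχb⟩, fun m => ?_⟩
  have hbd : bdry ψ =ᵐ[bMeasure] fun θ => ψ 0 + bdry (dslope ψ 0) θ * uc θ ^ (1 : ℤ) := by
    have e : ∀ z ∈ unitDisk, ψ z = ψ 0 + dslope ψ 0 z * z := fun z _ => by
      have := sub_smul_dslope ψ 0 z
      simp only [sub_zero, smul_eq_mul] at this
      linear_combination -this
    rw [bdry_congr e]
    filter_upwards [hχ.ae_tendsto_bdry] with θ h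
    rw [zpow_one]
    exact bdry_eq_of_tendsto ((h.mul (tendsto_mul_uc θ)).const_add _)
  rw [circCoeff_congr hbd, circCoeff_add (hardyBdry_const _).integrable
    (integrable_mul_uc_zpow hχ.hardyBdry.integrable _), circCoeff_const, circCoeff_mul_uc_zpow,
    if_neg (by omega), zero_add, add_sub_cancel_right]

lemma exists_backward_shift_iterate {ψ : ℂ → ℂ} (hd : DifferentiableOn ℂ ψ unitDisk)
    (hb : ∃ C : ℝ, ∀ z ∈ unitDisk, ‖ψ z‖ ≤ C) (k : ℕ) :
    ∃ χ : ℂ → ℂ, DifferentiableOn ℂ χ unitDisk ∧ (∃ C : ℝ, ∀ z ∈ unitDisk, ‖χ z‖ ≤ C) ∧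
      ∀ m : ℕ, circCoeff (bdry χ) m = circCoeff (bdry ψ) (m + k) := by
  induction k with
  | zero => exact ⟨ψ, hd, hb, fun m => by simp⟩
  | succ k ih =>
    obtain ⟨χ, h1, h2, h3⟩ := ih
    obtain ⟨χ', h1', h2', h3'⟩ := exists_backward_shift h1 h2
    refine ⟨χ', h1', h2', fun m => ?_⟩
    rw [h3' m]
    have := h3 (m + 1)
    push_cast at this ⊢
    rw [this]
    congr 1
    ring

lemma hardyBdry_conj_uc_mul {q : ℝ → ℂ} (hq : MemLp q 2 bMeasure)
    (hc : ∀ n : ℕ, circCoeff q n = 0) : HardyBdry fun θ => (starRingEnd ℂ) (uc θ * q θ) := by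
  have hm2 : MemLp (fun θ => uc θ * q θ) 2 bMeasure := by
    simpa [mul_comm] using memLp_mul_uc_zpow hq 1
  refine ⟨memLp_conj hm2, fun n hn => ?_⟩
  rw [circCoeff_conj, circCoeff_congr (G := fun θ => q θ * uc θ ^ (1 : ℤ))
    (.of_forall fun θ => by simp [mul_comm]), circCoeff_mul_uc_zpow]
  obtain ⟨k, hk⟩ : ∃ k : ℕ, -n - 1 = k := ⟨(-n - 1).toNat, by omega⟩
  rw [hk, hc, map_zero]

section

variable {I : ℂ → ℂ}

lemma memLp_conj_inner_mul (hI : IsInner I) {F : ℝ → ℂ} (hF : MemLp F 2 bMeasure) :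
    MemLp (fun θ => (starRingEnd ℂ) (bdry I θ) * F θ) 2 bMeasure := by
  have := memLp_mul_bounded (G := fun θ => (starRingEnd ℂ) (bdry I θ)) (C := 1) hF
    (memLp_conj hI.memH2.hardyBdry.1).1 (by
      filter_upwards [hI.2.2] with θ hθ
      rw [RCLike.norm_conj, hθ])
  simpa only [mul_comm] using this

lemma inner_conj_mul_self (hI : IsInner I) :
    ∀ᵐ θ ∂bMeasure, bdry I θ * (starRingEnd ℂ) (bdry I θ) = 1 := by
  filter_upwards [hI.2.2] with θ hθ
  rw [Complex.mul_conj, Complex.normSq_eq_norm_sq, hθ]; simp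

lemma circCoeff_bdry_inner_nonpos (hI : IsInner I) (hI0 : I 0 = 0) {n : ℤ} (hn : n ≤ 0) :
    circCoeff (bdry I) n = 0 := by
  rcases hn.lt_or_eq with h | rfl
  · exact hI.memH2.hardyBdry.2 n h
  · rw [hI.memH2.circCoeff_zero, hI0]

/-- `ι - u ^ j Ψ` has spectrum below `j` when `Ψ` is the `j`-fold backward shift of `ι`. -/
lemma circCoeff_sub_shift {F Ψ : ℝ → ℂ} (hF : Integrable F bMeasure) (hΨ : Integrable Ψ bMeasure)
    {j : ℕ} (h : ∀ m : ℕ, circCoeff Ψ m = circCoeff F (m + j)) {n : ℤ} (hn : j ≤ n) :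
    circCoeff (fun θ => F θ - Ψ θ * uc θ ^ (j : ℤ)) n = 0 := by
  rw [circCoeff_sub hF (integrable_mul_uc_zpow hΨ _), circCoeff_mul_uc_zpow]
  obtain ⟨m, hm⟩ : ∃ m : ℕ, n - j = m := ⟨(n - j).toNat, by omega⟩
  rw [hm, h, ← hm, sub_add_cancel, sub_self]

lemma circCoeff_conj_inner_mul_shift (hI : IsInner I) (hI0 : I 0 = 0) {Ψ : ℝ → ℂ}
    (hΨ : MemLp Ψ 2 bMeasure) {j : ℕ} (hj : 2 ≤ j)
    (h : ∀ m : ℕ, circCoeff Ψ m = circCoeff (bdry I) (m + j)) {n : ℤ} (hn : -1 ≤ n) :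
    circCoeff (fun θ => (starRingEnd ℂ) (bdry I θ) * Ψ θ) n = 0 := by
  have hF := hI.memH2.hardyBdry
  set W : ℝ → ℂ := fun θ => bdry I θ - Ψ θ * uc θ ^ (j : ℤ) with hW
  have hWm : MemLp W 2 bMeasure := hF.1.sub (memLp_mul_uc_zpow hΨ _)
  have h0 := integral_mul_conj_eq_zero (memLp_mul_uc_zpow hWm (-(j + n))) hF.1 fun m => by
    rw [circCoeff_mul_uc_zpow]
    rcases le_or_gt m 0 with hm | hm
    · exact .inr (circCoeff_bdry_inner_nonpos hI hI0 hm)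
    · exact .inl (circCoeff_sub_shift hF.integrable (hΨ.integrable (by norm_num)) h (by omega))
  have h1 : circCoeff (fun _ => 1) (j + n) = 0 := by
    rw [circCoeff_const, if_neg (by omega)]
  rw [circCoeff] at h1 ⊢
  have i0 : Integrable (fun θ => W θ * uc θ ^ (-(j + n)) * (starRingEnd ℂ) (bdry I θ)) bMeasure :=
    MemLp.integrable_mul (memLp_mul_uc_zpow hWm _) (memLp_conj hF.1)
  have i1 : Integrable (fun θ => (1 : ℂ) * uc θ ^ (-(j + n))) bMeasure :=
    integrable_mul_uc_zpow (hardyBdry_const 1).integrable _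
  have hs := integral_sub i1 i0
  rw [h0, sub_zero] at hs
  rw [← h1, ← hs]
  congr 1
  refine integral_congr_ae ?_
  filter_upwards [inner_conj_mul_self hI] with θ hθ
  have e1 : uc θ ^ (j : ℤ) * uc θ ^ (-(j + n)) = uc θ ^ (-n) := by
    rw [← zpow_add₀ (uc_ne_zero θ)]; congr 1; ring
  simp only [hW]
  linear_combination (-(starRingEnd ℂ) (bdry I θ) * Ψ θ) * e1 + uc θ ^ (-(j + n)) * hθ

/-- Multiples by `1 + z` of iterated backward shifts of `I` lie in the model space. -/
lemma one_add_mul_mem_modelSpace (hI : IsInner I) (hI0 : I 0 = 0) {χ : ℂ → ℂ}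
    (hχ : MemH2 χ) {j : ℕ} (hj : 2 ≤ j)
    (h : ∀ m : ℕ, circCoeff (bdry χ) m = circCoeff (bdry I) (m + j)) :
    (fun z => (1 + z) * χ z) ∈ modelSpace I := by
  have hp : MemH2 fun z => (1 + z) * χ z := hχ.mul_bounded (g := fun z => 1 + z) (by fun_prop)
    (C := 2) fun z hz => (norm_add_le _ _).trans (by
      rw [norm_one]; linarith [mem_unitDisk.1 hz])
  refine ⟨hp, fun z hz => ?_⟩
  have hb := bdry_mul_of_continuous (s := fun z => 1 + z) hχ (.of_forall fun θ => by fun_prop)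
  have hm := memLp_conj_inner_mul hI hχ.hardyBdry.1
  have hmi := hm.integrable (q := 2) (by norm_num)
  rw [toeplitz]
  refine szProj_eq_zero ((memLp_conj_inner_mul hI hp.hardyBdry.1).integrable (by norm_num))
    (fun n => ?_) z hz
  rw [circCoeff_congr (G := fun θ => (starRingEnd ℂ) (bdry I θ) * bdry χ θ +
    ((starRingEnd ℂ) (bdry I θ) * bdry χ θ) * uc θ ^ (1 : ℤ)),
    circCoeff_add hmi (integrable_mul_uc_zpow hmi _), circCoeff_mul_uc_zpow,
    circCoeff_conj_inner_mul_shift hI hI0 hχ.hardyBdry.1 hj h (by omega),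
    circCoeff_conj_inner_mul_shift hI hI0 hχ.hardyBdry.1 hj h (by omega), add_zero]
  filter_upwards [hb] with θ h1
  simp only [h1, zpow_one]
  ring

/-- The conjugate-analytic partner of an element of the Toeplitz kernel. -/
lemma exists_symm_of_mem_toeplitzKer (hI : IsInner I) {h : ℂ → ℂ}
    (hh : h ∈ toeplitzKer (symbIf I fun z => (1 + z) / 2 * wz I z))
    (hI0 : I 0 = 0) :
    ∃ K : ℝ → ℂ, HardyBdry K ∧ ∀ᵐ θ ∂bMeasure,
      (starRingEnd ℂ) (K θ) * (starRingEnd ℂ) (dB I θ) =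
        (starRingEnd ℂ) (bdry I θ) * dB I θ * bdry h θ := by
  set φ := symbIf I fun z => (1 + z) / 2 * wz I z with hφ
  have hφm : AEStronglyMeasurable φ bMeasure := by
    have h1 := (memLp_conj hI.memH2.hardyBdry.1).1.aemeasurable
    have h2 := (memH2_mul_wz hI hI0).hardyBdry.1.1.aemeasurable
    have h3 := (memLp_conj (memH2_mul_wz hI hI0).hardyBdry.1).1.aemeasurable
    exact ((h1.mul h3).div h2).aestronglyMeasurable
  have hφb : ∀ᵐ θ ∂bMeasure, ‖φ θ‖ ≤ 1 := by
    filter_upwards [hI.2.2] with θ hθ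
    rw [hφ, symbIf, norm_div, norm_mul, RCLike.norm_conj, RCLike.norm_conj, hθ, one_mul]
    exact div_self_le_one _
  have hq : MemLp (fun θ => φ θ * bdry h θ) 2 bMeasure := by
    simpa only [mul_comm] using memLp_mul_bounded hh.1.hardyBdry.1 hφm hφb
  refine ⟨_, hardyBdry_conj_uc_mul hq
    (circCoeff_eq_zero_of_szProj (hq.integrable (by norm_num)) hh.2), ?_⟩
  filter_upwards [symbIf_spec hI] with θ h1
  rw [Complex.conj_conj]
  linear_combination bdry h θ * h1

end

/-! ### Elements of the orthogonal complement -/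

section

variable {I : ℂ → ℂ}

lemma integral_mul_conj_shift_eq_zero (hI : IsInner I) (hI0 : I 0 = 0) {h : ℂ → ℂ}
    (hh : h ∈ kerPerp I fun z => (1 + z) / 2 * wz I z) {χ : ℂ → ℂ}
    (hχd : DifferentiableOn ℂ χ unitDisk) {C : ℝ} (hχb : ∀ z ∈ unitDisk, ‖χ z‖ ≤ C)
    {j : ℕ} (hj : 2 ≤ j)
    (hs : ∀ m : ℕ, circCoeff (bdry χ) m = circCoeff (bdry I) (m + j)) :
    ∫ θ, bdry h θ * (starRingEnd ℂ) (bdry χ θ * uc θ) ∂bMeasure = 0 := by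
  have hχ : MemH2 χ := MemH2.of_bounded hχd hχb
  obtain ⟨K, hK, hKe⟩ := exists_symm_of_mem_toeplitzKer hI hh.1 hI0
  have hH := hh.1.1.hardyBdry
  have hbχ : MemH2 fun z => bz z * χ z :=
    hχ.mul_bounded differentiable_bz.differentiableOn (C := 1) fun z hz => (norm_bz_lt_one hz).le
  have h0 := hh.2 (fun z => (1 + z) / 2 * wz I z * ((1 + z) * χ z))
    ⟨_, one_add_mul_mem_modelSpace hI hI0 hχ hj hs, fun z _ => rfl⟩
  rw [bInner, ← integral_bMeasure] at h0
  have h0' := (mul_eq_zero.1 h0).resolve_left (by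
    have := Real.pi_pos.ne'
    simp [this])
  have i1 : Integrable (fun θ => bdry h θ * (starRingEnd ℂ) (bdry χ θ * uc θ)) bMeasure := by
    have := memLp_mul_uc_zpow hχ.hardyBdry.1 1
    simp only [zpow_one] at this
    exact hH.1.integrable_mul (memLp_conj this)
  have i2' : Integrable
      (fun θ => K θ * (bdry (fun z => bz z * χ z) θ * uc θ ^ (0 + 1))) bMeasure := by
    have := memLp_mul_uc_zpow hbχ.hardyBdry.1 1
    simp only [zpow_one] at this
    simp only [zero_add, pow_one]
    exact hK.1.integrable_mul this
  have z2 := HardyBdry.integral_mul_uc hK hbχ.hardyBdry 0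
  have i2 : Integrable (fun θ => (starRingEnd ℂ)
      (K θ * (bdry (fun z => bz z * χ z) θ * uc θ ^ (0 + 1)))) bMeasure :=
    (LinearIsometryEquiv.integrable_comp_iff (Complex.conjLIE)).2 i2'
  have e : ∀ᵐ θ ∂bMeasure, bdry h θ * (starRingEnd ℂ)
      (bdry (fun z => (1 + z) / 2 * wz I z * ((1 + z) * χ z)) θ) =
      2 * (bdry h θ * (starRingEnd ℂ) (bdry χ θ * uc θ)) + 2 * (starRingEnd ℂ)
      (K θ * (bdry (fun z => bz z * χ z) θ * uc θ ^ (0 + 1))) := by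
    have hp : MemH2 fun z => (1 + z) * χ z :=
      (one_add_mul_mem_modelSpace hI hI0 hχ hj hs).1
    filter_upwards [(memH2_mul_wz hI hI0).bdry_mul hp, hKe, mul_conj_fz_mul hI,
      bdry_mul_of_continuous (s := bz) hχ
        (.of_forall fun θ => differentiable_bz.continuous.continuousAt),
      bdry_mul_of_continuous (s := fun z => 1 + z) hχ (.of_forall fun θ => by fun_prop)]
      with θ h1 h2 h3 h4 h5
    rw [h1, h4, h5]
    have h6 := h3 _ _ h2
    simp only [map_mul, map_add, map_one, conj_uc, zero_add, pow_one] at h6 ⊢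
    linear_combination (starRingEnd ℂ) (bdry χ θ) * h6
  rw [integral_congr_ae e, integral_add (i1.const_mul 2) (i2.const_mul 2), integral_const_mul,
    integral_const_mul, integral_conj, z2, map_zero, mul_zero, add_zero] at h0'
  exact (mul_eq_zero.1 h0').resolve_left two_ne_zero

lemma hardyBdry_conj_inner_mul_sub (hI : IsInner I) (hI0 : I 0 = 0) {h : ℂ → ℂ}
    (hh : h ∈ kerPerp I fun z => (1 + z) / 2 * wz I z) :
    HardyBdry fun θ => (starRingEnd ℂ) (bdry I θ) * (bdry h θ - h 0) := by
  have hH := hh.1.1.hardyBdry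
  have hG : HardyBdry fun θ => bdry h θ - h 0 := hH.sub (hardyBdry_const _)
  have hG0 : ∀ n ≤ 0, circCoeff (fun θ => bdry h θ - h 0) n = 0 := fun n hn => by
    rcases hn.lt_or_eq with hn | rfl
    · exact hG.2 n hn
    · rw [circCoeff_sub hH.integrable (hardyBdry_const _).integrable, circCoeff_const,
        if_pos rfl, hh.1.1.circCoeff_zero, sub_self]
  refine ⟨memLp_conj_inner_mul hI hG.1, fun n hn => ?_⟩
  obtain ⟨k, rfl⟩ : ∃ k : ℕ, n = -k := ⟨n.natAbs, by omega⟩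
  obtain ⟨χ, hχd, ⟨C, hχb⟩, hs⟩ := exists_backward_shift_iterate hI.1 ⟨1, hI.2.1⟩ (k + 1)
  have hF := hI.memH2.hardyBdry
  have hχ : HardyBdry (bdry χ) := (MemH2.of_bounded hχd hχb).hardyBdry
  have h1 := integral_mul_conj_shift_eq_zero hI hI0 hh hχd hχb (j := k + 1) (by omega) hs
  set W : ℝ → ℂ := fun θ => bdry I θ - bdry χ θ * uc θ ^ ((k + 1 : ℕ) : ℤ) with hW
  have hWm : MemLp W 2 bMeasure := hF.1.sub (memLp_mul_uc_zpow hχ.1 _)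
  have h2 := integral_mul_conj_eq_zero (memLp_mul_uc_zpow hG.1 k) hWm fun m => by
    rw [circCoeff_mul_uc_zpow]
    rcases le_or_gt m k with hm | hm
    · exact .inl (hG0 _ (by omega))
    · exact .inr (circCoeff_sub_shift hF.integrable hχ.integrable hs (by push_cast; omega))
  have h3 : ∫ θ, (starRingEnd ℂ) (bdry χ θ * uc θ) ∂bMeasure = 0 := by
    have := HardyBdry.integral_mul_uc (hardyBdry_const 1) hχ 0
    simp only [one_mul, zero_add, pow_one] at this
    rw [integral_conj, this, map_zero]
  have hm := memLp_mul_uc_zpow hχ.1 1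
  simp only [zpow_one] at hm
  have i1 : Integrable (fun θ => bdry h θ * (starRingEnd ℂ) (bdry χ θ * uc θ)) bMeasure :=
    hH.1.integrable_mul (memLp_conj hm)
  have i2 : Integrable (fun θ => (bdry h θ - h 0) * uc θ ^ (k : ℤ) * (starRingEnd ℂ) (W θ))
      bMeasure := (memLp_mul_uc_zpow hG.1 k).integrable_mul (memLp_conj hWm)
  have i3 : Integrable (fun θ => h 0 * (starRingEnd ℂ) (bdry χ θ * uc θ)) bMeasure :=
    ((memLp_conj hm).integrable (by norm_num)).const_mul _
  rw [circCoeff]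
  convert mul_zero _
  have e : ∀ θ, (starRingEnd ℂ) (bdry I θ) * (bdry h θ - h 0) * uc θ ^ (-(-(k : ℤ))) =
      (bdry h θ - h 0) * uc θ ^ (k : ℤ) * (starRingEnd ℂ) (W θ) +
      (bdry h θ * (starRingEnd ℂ) (bdry χ θ * uc θ) -
        h 0 * (starRingEnd ℂ) (bdry χ θ * uc θ)) := fun θ => by
    have e1 : uc θ ^ k * (uc θ)⁻¹ ^ (k + 1) = (uc θ)⁻¹ := by
      rw [pow_succ, ← mul_assoc, ← mul_pow, mul_inv_cancel₀ (uc_ne_zero θ), one_pow, one_mul]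
    simp only [hW, neg_neg, zpow_natCast, map_sub, map_mul, map_pow, conj_uc]
    linear_combination ((bdry h θ - h 0) * (starRingEnd ℂ) (bdry χ θ)) * e1
  simp only [e]
  have e4 := integral_add i2 (i1.sub i3)
  simp only [Pi.sub_apply] at e4
  rw [e4, integral_sub i1 i3, integral_const_mul, h1, h2, h3]
  ring

/-- Elements of the orthogonal complement are `(c + e I) / (1 - b)`. -/
lemma exists_eq_of_mem_kerPerp (hI : IsInner I) (hI0 : I 0 = 0) {h : ℂ → ℂ}
    (hh : h ∈ kerPerp I fun z => (1 + z) / 2 * wz I z) :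
    ∃ e : ℂ, ∀ z ∈ unitDisk, h z = (h 0 + e * I z) * wz I z := by
  obtain ⟨K, hK, hKe⟩ := exists_symm_of_mem_toeplitzKer hI hh.1 hI0
  have hM := hardyBdry_conj_inner_mul_sub hI hI0 hh
  set c := h 0 with hc
  have hdd : DifferentiableOn ℂ (fun z => 1 - I z * bz z) unitDisk :=
    (hI.1.mul differentiable_bz.differentiableOn).const_sub 1
  have hdb : ∀ z ∈ unitDisk, ‖1 - I z * bz z‖ ≤ 2 := fun z hz =>
    (norm_sub_le _ _).trans (by rw [norm_one]; linarith [norm_mul_bz_lt_one hI hz])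
  have hD : HardyBdry (bdry fun z => 1 - I z * bz z) := (MemH2.of_bounded hdd hdb).hardyBdry
  have hbzt : ∀ θ, Tendsto (fun t : ℝ => bz (t * uc θ)) (nhdsWithin 1 (Iio 1))
      (nhds (bz (uc θ))) := fun θ =>
    (differentiable_bz.continuous.tendsto _).comp (tendsto_mul_uc θ)
  have hDe : bdry (fun z => 1 - I z * bz z) =ᵐ[bMeasure] dB I := by
    filter_upwards [hI.ae_boundary] with θ h1
    exact bdry_eq_of_tendsto ((h1.2.2.2.1.mul (hbzt θ)).const_sub 1)
  have hD' : HardyBdry (dB I) := hD.congr hDe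
  have hDb : ∀ᵐ θ ∂bMeasure, ‖dB I θ‖ ≤ 2 := by
    filter_upwards [hI.2.2, ae_bMeasure ae_uc_ne_neg_one] with θ h1 h2
    rw [dB]
    refine (norm_sub_le _ _).trans ?_
    rw [norm_one, norm_mul, h1]
    have := norm_bz_uc_lt_one (norm_uc θ) h2
    linarith
  have hbz : HardyBdry fun θ => bz (uc θ) := by
    have := (MemH2.of_bounded differentiable_bz.differentiableOn (C := 1)
      fun z hz => (norm_bz_lt_one hz).le).hardyBdry
    exact this.congr (.of_forall fun θ => bdry_eq_of_tendsto (hbzt θ))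
  have hT : HardyBdry fun θ => (starRingEnd ℂ) (bdry I θ) * (bdry h θ - c) * dB I θ -
      c * bz (uc θ) :=
    (hM.mul hD' (memLp_mul_bounded hM.1 hD'.1.1 hDb)).sub (hbz.const_mul c)
  have hKD : HardyBdry fun θ => K θ * dB I θ :=
    hK.mul hD' (memLp_mul_bounded hK.1 hD'.1.1 hDb)
  have hS : HardyBdry fun θ => K θ * dB I θ - (starRingEnd ℂ) c * bdry I θ :=
    hKD.sub (hI.memH2.hardyBdry.const_mul _)
  have hTS : (fun θ => (starRingEnd ℂ) (bdry I θ) * (bdry h θ - c) * dB I θ -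
      c * bz (uc θ)) =ᵐ[bMeasure]
      fun θ => (starRingEnd ℂ) (K θ * dB I θ - (starRingEnd ℂ) c * bdry I θ) := by
    filter_upwards [hKe, inner_conj_mul_self hI] with θ h1 h2
    simp only [map_sub, map_mul, Complex.conj_conj]
    rw [h1, dB]
    linear_combination (c * bz (uc θ)) * h2
  set T : ℝ → ℂ := fun θ => (starRingEnd ℂ) (bdry I θ) * (bdry h θ - c) * dB I θ -
      c * bz (uc θ) with hTdef
  set e := circCoeff T 0 with he
  have hTe : (fun θ => T θ - e) =ᵐ[bMeasure] 0 := by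
    refine ae_eq_zero_of_circCoeff (hT.1.sub (hardyBdry_const e).1) fun n => ?_
    rw [circCoeff_sub hT.integrable (hardyBdry_const e).integrable, circCoeff_const]
    rcases lt_trichotomy n 0 with hn | rfl | hn
    · rw [hT.2 n hn, if_neg hn.ne, sub_zero]
    · rw [if_pos rfl, he, sub_self]
    · rw [if_neg hn.ne', sub_zero, circCoeff_congr hTS, circCoeff_conj, hS.2 _ (by omega),
        map_zero]
  refine ⟨e, fun z hz => ?_⟩
  have h1 : MemH2 fun z => (1 - I z * bz z) * h z := hh.1.1.mul_bounded hdd hdb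
  have h2 : MemH2 fun z => c + e * I z := by
    refine MemH2.of_bounded ((hI.1.const_mul e).const_add c) (C := ‖c‖ + ‖e‖) fun z hz => ?_
    refine (norm_add_le _ _).trans ?_
    rw [norm_mul]
    have := mul_le_of_le_one_right (norm_nonneg e) (hI.2.1 z hz)
    linarith
  have h3 : (1 - I z * bz z) * h z = c + e * I z := by
    refine h1.eq_of_bdry h2 ?_ (mem_unitDisk.1 hz)
    filter_upwards [(MemH2.of_bounded hdd hdb).bdry_mul hh.1.1, hDe, hI.ae_boundary,
      inner_conj_mul_self hI, hTe] with θ g1 g2 g3 g4 g5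
    rw [g1, g2, bdry_eq_of_tendsto (h := fun z => c + e * I z)
      ((g3.2.2.2.1.const_mul e).const_add c)]
    simp only [hTdef, Pi.zero_apply] at g5
    rw [dB] at g5 ⊢
    linear_combination bdry I θ * g5 - (bdry h θ - c) * (1 - bdry I θ * bz (uc θ)) * g4
  have hne := one_sub_ne_zero_of_norm_lt (norm_mul_bz_lt_one hI hz)
  rw [wz, ← h3]
  field_simp

end

/-! ### The function `1 / (1 - b)` is not in `H²` -/

lemma re_two_mul_inv_sub_one {v : ℂ} (hv : 1 - v ≠ 0) :
    (2 * (1 - v)⁻¹ - 1).re = (1 - ‖v‖ ^ 2) * ‖(1 - v)⁻¹‖ ^ 2 := by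
  have h1 : ‖1 - v‖ ^ 2 = 1 - 2 * v.re + ‖v‖ ^ 2 := by
    rw [Complex.sq_norm, Complex.sq_norm, Complex.normSq_apply, Complex.normSq_apply]
    simp only [Complex.sub_re, Complex.sub_im, Complex.one_re, Complex.one_im]
    ring
  have h2 : ‖1 - v‖ ^ 2 ≠ 0 := pow_ne_zero 2 (norm_ne_zero_iff.2 hv)
  have h3 : ((1 - v)⁻¹).re = (1 - v.re) / ‖1 - v‖ ^ 2 := by
    rw [Complex.inv_re, Complex.sq_norm]
    simp
  have h4 : (2 * (1 - v)⁻¹).re = 2 * ((1 - v)⁻¹).re := by simp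
  rw [Complex.sub_re, Complex.one_re, h4, h3, norm_inv]
  field_simp
  rw [h1]
  ring

lemma one_sub_two_mul_re_add_sq (z : ℂ) (θ : ℝ) :
    1 - 2 * (z * (uc θ)⁻¹).re + ‖z‖ ^ 2 = ‖1 - z * (uc θ)⁻¹‖ ^ 2 := by
  rw [← norm_mul_inv_uc z θ, Complex.sq_norm, Complex.sq_norm, Complex.normSq_apply,
    Complex.normSq_apply]
  simp only [Complex.sub_re, Complex.sub_im, Complex.one_re, Complex.one_im]
  ring

lemma not_memH2_wz {r : ℕ → ℝ} (hr : ∀ n, r n ∈ Ioo (-1 : ℝ) 0)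
    (hrlim : Tendsto r atTop (nhds (-1))) {I : ℂ → ℂ} (hI : IsInner I)
    (hIr : ∀ n, I (r n) = 0) : ¬ MemH2 (wz I) := by
  intro hw
  have hg : MemH2 fun z => 2 * wz I z + -1 :=
    (hw.const_mul 2).add (MemH2.of_bounded (differentiableOn_const _) fun _ _ => le_rfl)
  have hgb : ∀ᵐ θ ∂bMeasure, (bdry (fun z => 2 * wz I z + -1) θ).re =
      ‖(1 + uc θ) / 2‖ ^ 2 * ‖bdry (wz I) θ‖ ^ 2 := by
    filter_upwards [hI.ae_boundary, bdry_wz hI] with θ h1 h2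
    rw [bdry_eq_of_tendsto (h := fun z => 2 * wz I z + -1)
      ((h1.2.2.2.2.const_mul 2).add_const (-1)), h2, dB, ← sub_eq_add_neg,
      re_two_mul_inv_sub_one h1.2.2.1, norm_mul, h1.2.1, one_mul,
      ← sq_add_sq_bz_eq (norm_uc θ), add_sub_cancel_right]
  have key : ∀ n, 2 * Real.pi ≤ (1 - r n ^ 2) * ∫ θ, ‖bdry (wz I) θ‖ ^ 2 ∂bMeasure := fun n => by
    have hz : ‖(r n : ℂ)‖ < 1 := by
      rw [Complex.norm_real, Real.norm_eq_abs, abs_lt]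
      exact ⟨(hr n).1, by linarith [(hr n).2]⟩
    have h1 := hg.eq_szProj hz
    rw [szProj_eq_integral_poissonKernel hg.hardyBdry hz] at h1
    set P : ℝ → ℝ := fun θ =>
      (1 - ‖(r n : ℂ)‖ ^ 2) / (1 - 2 * ((r n : ℂ) * (uc θ)⁻¹).re + ‖(r n : ℂ)‖ ^ 2) with hP
    have h2 : ∫ θ, bdry (fun z => 2 * wz I z + -1) θ * (P θ : ℂ) ∂bMeasure =
        2 * (Real.pi : ℂ) := by
      have hpi : (Real.pi : ℂ) ≠ 0 := by exact_mod_cast Real.pi_pos.ne'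
      rw [wz, hIr, zero_mul, sub_zero, inv_one] at h1
      set X := ∫ θ, bdry (fun z => 2 * wz I z + -1) θ * (P θ : ℂ) ∂bMeasure
      replace h1 : 2 * 1 + -1 = 1 / (2 * (Real.pi : ℂ)) * X := h1
      field_simp at h1
      linear_combination -h1
    have hint : Integrable (fun θ => bdry (fun z => 2 * wz I z + -1) θ * (P θ : ℂ)) bMeasure := by
      by_contra hc
      rw [integral_undef hc] at h2
      have hpi : (Real.pi : ℂ) ≠ 0 := by exact_mod_cast Real.pi_pos.ne'
      exact mul_ne_zero two_ne_zero hpi h2.symm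
    have h3 : ∫ θ, (bdry (fun z => 2 * wz I z + -1) θ * (P θ : ℂ)).re ∂bMeasure =
        2 * Real.pi := by
      have := integral_re hint
      simp only [RCLike.re_eq_complex_re] at this
      rw [this, h2]
      simp
    rw [← h3, ← integral_const_mul]
    refine integral_mono_ae hint.re (hw.hardyBdry.1.integrable_norm_pow (by norm_num)
      |>.const_mul _) ?_
    filter_upwards [hgb] with θ h4
    have h5 := norm_one_add_le_two_mul (hr n) (norm_inv_uc θ).le
    have h6 := norm_pos_iff.2 (one_sub_mul_ne_zero (hr n) (norm_inv_uc θ).le)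
    have h7 : ‖(1 + uc θ) / 2‖ ≤ ‖1 - (r n : ℂ) * (uc θ)⁻¹‖ := by
      have : 1 + uc θ = uc θ * (1 + (uc θ)⁻¹) := by
        rw [mul_add, mul_inv_cancel₀ (uc_ne_zero θ)]; ring
      rw [norm_div, this, norm_mul, norm_uc, one_mul, Complex.norm_ofNat]
      linarith
    have h8 : ‖(r n : ℂ)‖ ^ 2 = r n ^ 2 := by rw [Complex.norm_real, Real.norm_eq_abs, sq_abs]
    change (bdry (fun z => 2 * wz I z + -1) θ * (P θ : ℂ)).re ≤ _
    rw [Complex.re_mul_ofReal, h4, hP]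
    simp only
    rw [one_sub_two_mul_re_add_sq, h8, mul_div_assoc', div_le_iff₀ (by positivity)]
    have h9 : 0 ≤ 1 - r n ^ 2 := by nlinarith [(hr n).1, (hr n).2]
    have h10 := pow_le_pow_left₀ (norm_nonneg _) h7 2
    have h11 : 0 ≤ (1 - r n ^ 2) * ‖bdry (wz I) θ‖ ^ 2 := by positivity
    nlinarith [mul_le_mul_of_nonneg_left h10 h11]
  have hlim : Tendsto (fun n => (1 - r n ^ 2) * ∫ θ, ‖bdry (wz I) θ‖ ^ 2 ∂bMeasure) atTop
      (nhds ((1 - (-1) ^ 2) * ∫ θ, ‖bdry (wz I) θ‖ ^ 2 ∂bMeasure)) :=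
    ((hrlim.pow 2).const_sub 1).mul_const _
  have := ge_of_tendsto' hlim key
  norm_num at this
  linarith [Real.pi_pos]

/-- Elements of the orthogonal complement are multiples of `g`. -/
lemma eq_const_mul_gz_of_mem_kerPerp {r : ℕ → ℝ} (hr : ∀ n, r n ∈ Ioo (-1 : ℝ) 0)
    (hrlim : Tendsto r atTop (nhds (-1))) {I : ℂ → ℂ} (hI : IsInner I) (hI0 : I 0 = 0)
    (hIr : ∀ n, I (r n) = 0) {h : ℂ → ℂ} (hh : h ∈ kerPerp I fun z => (1 + z) / 2 * wz I z) :
    ∃ c : ℂ, ∀ z ∈ unitDisk, h z = c * gz I z := by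
  obtain ⟨e, he⟩ := exists_eq_of_mem_kerPerp hI hI0 hh
  have hec : h 0 = e := by
    by_contra hne
    have hne' := sub_ne_zero.2 hne
    refine not_memH2_wz hr hrlim hI hIr (((hh.1.1.add
      ((memH2_gz hI hI0).const_mul (-2 * e))).const_mul (h 0 - e)⁻¹).congr fun z hz => ?_)
    rw [he z hz, gz]
    field_simp
    ring
  refine ⟨2 * e, fun z hz => ?_⟩
  rw [he z hz, hec, gz]
  ring

/-- The Example, (4.1).  Let `a(z) = (1+z)/2`, `b₀(z) = z(1−z)/2`,
`I(z) = zB(z)` with `B` the Blaschke product with zeros `rₙ ∈ (−1, 0)`, `rₙ → −1`,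
`b = I·b₀` and `f = a/(1−b)`.  Then `ker T_{Ī f̄/f} ⊖ f·K_I` is one dimensional,
spanned by `g = f·(1+I)/(1+z)`. -/
theorem kerPerp_one_dimensional (r : ℕ → ℝ)
    (hr : ∀ n, r n ∈ Set.Ioo (-1 : ℝ) 0)
    (hrlim : Filter.Tendsto r Filter.atTop (nhds (-1)))
    (hblaschke : Summable fun n => 1 + r n)
    (B a b₀ I f : ℂ → ℂ)
    (hB : ∀ z ∈ unitDisk, B z = ∏' n, ((z - (r n : ℂ)) / (1 - (r n : ℂ) * z)))
    (ha : ∀ z, a z = (1 + z) / 2)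
    (hb₀ : ∀ z, b₀ z = z * (1 - z) / 2)
    (hI : ∀ z, I z = z * B z)
    (hf : ∀ z, f z = a z / (1 - I z * b₀ z)) :
    kerPerp I f =
      {h : ℂ → ℂ | ∃ c : ℂ, ∀ z ∈ unitDisk,
        h z = c * (f z * (1 + I z) / (1 + z))} := by
  have hIB : ∀ z ∈ unitDisk, I z = z * blaschkeProd r z := fun z hz => by
    rw [hI, hB z hz, blaschkeProd]
  have hIin : IsInner I := (isInner_mul_blaschkeProd hr hblaschke).congr hIB
  have hI0 : I 0 = 0 := by rw [hI, zero_mul]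
  have hIr : ∀ n, I (r n) = 0 := fun n => by
    have hz : (r n : ℂ) ∈ unitDisk := by
      rw [mem_unitDisk, Complex.norm_real, Real.norm_eq_abs, abs_lt]
      exact ⟨(hr n).1, by linarith [(hr n).2]⟩
    rw [hIB _ hz, blaschkeProd_zero hr hblaschke n, mul_zero]
  have hf' : f = fun z => (1 + z) / 2 * wz I z := by
    funext z
    rw [hf, ha, hb₀, wz, bz, div_eq_mul_inv]
  have hg : ∀ z ∈ unitDisk, f z * (1 + I z) / (1 + z) = gz I z := fun z hz => by
    have hz' : 1 + z ≠ 0 := fun e => ne_neg_one_of_mem hz (by linear_combination e)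
    rw [hf', gz]
    field_simp
  ext h
  constructor
  · intro hh
    rw [hf'] at hh
    obtain ⟨c, hc⟩ := eq_const_mul_gz_of_mem_kerPerp hr hrlim hIin hI0 hIr hh
    exact ⟨c, fun z hz => by rw [hc z hz, hg z hz]⟩
  · rintro ⟨c, hc⟩
    rw [hf']
    exact const_mul_gz_mem_kerPerp hr hrlim hIin hI0 hIr c fun z hz => by rw [hc z hz, hg z hz]

end
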